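/- arXiv:2507.15665 — 4 statements merged into one kernel-verified Lean document; each statement's English description precedes it below -/
import Mathlib

section
/- For every positive integer n, the determinant of the n×n matrix whose (i,j)-entry (0 ≤ i,j ≤ n−1) is 2^{j+1}·binom(2i+j+2, 2i+2) + binom(2i−j, 2i+2) equals the product over i = 1 to n of Γ(4i)·Γ((i+2)/2) / (Γ(3i)·Γ((3i+2)/2)). -/
open scoped BigOperators

/-- Generalized binomial coefficient: `binom α p = α(α−1)⋯(α−p+1)/p!`. -/
noncomputable def binom (α : ℤ) (p : ℕ) : ℝ :=
  (∏ k ∈ Finset.range p, ((α : ℝ) - (k : ℝ))) / (p.factorial : ℝ)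

section

open Polynomial Finset

section DifferentialOperators

variable {A : Type*} [CommRing A] [Algebra ℝ A]

/-- The constant-coefficient differential operator `p(D)`. -/
noncomputable def diffOp (D : Derivation ℝ A A) (p : ℝ[X]) : Module.End ℝ A :=
  aeval (D : Module.End ℝ A) p

variable (D : Derivation ℝ A A)

lemma diffOp_mul (p q : ℝ[X]) (F : A) : diffOp D (p * q) F = diffOp D p (diffOp D q F) := by
  simp [diffOp]

lemma diffOp_add (p q : ℝ[X]) (F : A) : diffOp D (p + q) F = diffOp D p F + diffOp D q F := by
  simp [diffOp]

lemma diffOp_sub (p q : ℝ[X]) (F : A) : diffOp D (p - q) F = diffOp D p F - diffOp D q F := by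
  simp [diffOp]

lemma diffOp_one (F : A) : diffOp D 1 F = F := by
  simp [diffOp]

lemma diffOp_C (r : ℝ) (F : A) : diffOp D (C r) F = r • F := by
  simp [diffOp, Algebra.algebraMap_eq_smul_one]

lemma diffOp_C_mul (r : ℝ) (p : ℝ[X]) (F : A) : diffOp D (C r * p) F = r • diffOp D p F := by
  rw [diffOp_mul, diffOp_C]

lemma diffOp_X (F : A) : diffOp D X F = D F := by
  simp [diffOp]

lemma diffOp_X_mul (p : ℝ[X]) (F : A) : diffOp D (X * p) F = D (diffOp D p F) := by
  rw [diffOp_mul, diffOp_X]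

lemma diffOp_X_pow_succ (j : ℕ) (F : A) : diffOp D (X ^ (j + 1)) F = diffOp D (X ^ j) (D F) := by
  rw [pow_succ, diffOp_mul, diffOp_X]

lemma diffOp_sq_add_C (r : ℝ) (F : A) : diffOp D (X ^ 2 + C r) F = D (D F) + r • F := by
  rw [diffOp_add, diffOp_C, sq, diffOp_X_mul, diffOp_X]

/-- The product of `x² + (r (j + 1))²` over `j < N`. -/
noncomputable def evenProd (r : ℝ) (N : ℕ) : ℝ[X] :=
  ∏ j ∈ range N, (X ^ 2 + C ((r * (j + 1)) ^ 2))

/-- The product of `x² + (r (2 j + 1))²` over `j < N`. -/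
noncomputable def oddProd (r : ℝ) (N : ℕ) : ℝ[X] :=
  ∏ j ∈ range N, (X ^ 2 + C ((r * (2 * j + 1)) ^ 2))

lemma evenProd_zero (r : ℝ) : evenProd r 0 = 1 := by simp [evenProd]

lemma oddProd_zero (r : ℝ) : oddProd r 0 = 1 := by simp [oddProd]

lemma evenProd_succ (r : ℝ) (N : ℕ) :
    evenProd r (N + 1) = (X ^ 2 + C ((r * (N + 1)) ^ 2)) * evenProd r N := by
  rw [evenProd, prod_range_succ, mul_comm, ← evenProd]

lemma oddProd_succ (r : ℝ) (N : ℕ) :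
    oddProd r (N + 1) = (X ^ 2 + C ((r * (2 * N + 1)) ^ 2)) * oddProd r N := by
  rw [oddProd, prod_range_succ, mul_comm, ← oddProd]

lemma evenProd_two_mul (r : ℝ) (k : ℕ) :
    evenProd r (2 * k) = evenProd (2 * r) k * oddProd r k := by
  induction k with
  | zero => simp [evenProd_zero, oddProd_zero]
  | succ k ih =>
    rw [mul_add_one, evenProd_succ, evenProd_succ, evenProd_succ, oddProd_succ, ih]
    push_cast
    rw [show (2 * r * (k + 1)) ^ 2 = (r * (2 * k + 1 + 1)) ^ 2 by ring]
    ring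

lemma evenProd_two_mul_add_one (r : ℝ) (k : ℕ) :
    evenProd r (2 * k + 1) = evenProd (2 * r) k * oddProd r (k + 1) := by
  rw [evenProd_succ, evenProd_two_mul, oddProd_succ]
  push_cast
  ring

lemma oddProd_diffOp_eq_smul {w : ℝ} {F : A} (hF : D (D F) = -(w ^ 2) • F) (r : ℝ) (N : ℕ) :
    diffOp D (oddProd r N) F = (∏ j ∈ range N, ((r * (2 * j + 1)) ^ 2 - w ^ 2)) • F := by
  induction N with
  | zero => simp [oddProd_zero, diffOp_one]
  | succ N ih =>
    rw [oddProd_succ, diffOp_mul, ih, diffOp_sq_add_C, prod_range_succ]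
    rw [D.map_smul, D.map_smul, hF]
    module

lemma oddProd_diffOp_eq_zero {r : ℝ} {F : A} (hF : D (D F) = -(r ^ 2) • F) (N : ℕ) :
    diffOp D (oddProd r (N + 1)) F = 0 := by
  rw [oddProd_diffOp_eq_smul D hF, prod_range_succ']
  simp

/-- Conjugating `oddProd` by the rotation `(c, σ)` of frequency `w` shifts its roots. -/
lemma diffOp_oddProd_mul_cos {w : ℝ} {c σ : A} (hc : D c = -w • σ) (hσ : D σ = w • c)
    (F : A) (N : ℕ) :
    diffOp D (oddProd w (N + 1)) (c * F) =
      c * diffOp D (X ^ 2 * evenProd (2 * w) N) F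
        - (2 * (N + 1) * w) • (σ * diffOp D (X * evenProd (2 * w) N) F) := by
  induction N with
  | zero =>
    rw [oddProd_succ, oddProd_zero, evenProd_zero, mul_one, mul_one, mul_one, diffOp_sq_add_C,
      sq X, diffOp_X_mul, diffOp_X]
    simp only [Derivation.leibniz, map_add, D.map_smul, hc, hσ, smul_eq_mul]
    simp only [Algebra.smul_def, map_add, map_mul, map_neg, map_pow, map_one, map_ofNat,
      map_zero, Nat.cast_zero]
    ring
  | succ N ih =>
    have h2 : diffOp D (X * evenProd (2 * w) (N + 1)) F =
        D (D (diffOp D (X * evenProd (2 * w) N) F))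
          + ((2 * w * (N + 1)) ^ 2) • diffOp D (X * evenProd (2 * w) N) F := by
      rw [evenProd_succ, mul_left_comm, diffOp_mul, diffOp_sq_add_C]
    have h3 (M : ℕ) : diffOp D (X ^ 2 * evenProd (2 * w) M) F =
        D (diffOp D (X * evenProd (2 * w) M) F) := by
      rw [sq X, mul_assoc, diffOp_X_mul]
    rw [oddProd_succ, diffOp_mul, ih, diffOp_sq_add_C, h3, h3, h2]
    generalize diffOp D (X * evenProd (2 * w) N) F = H
    simp only [Derivation.leibniz, map_add, map_sub, D.map_smul, hc, hσ, smul_eq_mul]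
    simp only [Algebra.smul_def, map_add, map_mul, map_neg, map_pow, map_one, map_ofNat,
      map_natCast, Nat.cast_add, Nat.cast_one]
    ring

lemma diffOp_oddProd_mul_sin {w : ℝ} {c σ : A} (hc : D c = -w • σ) (hσ : D σ = w • c)
    (F : A) (N : ℕ) :
    diffOp D (oddProd w (N + 1)) (σ * F) =
      σ * diffOp D (X ^ 2 * evenProd (2 * w) N) F
        + (2 * (N + 1) * w) • (c * diffOp D (X * evenProd (2 * w) N) F) := by
  have h := diffOp_oddProd_mul_cos D (w := w) (c := σ) (σ := -c) (by simpa using hσ)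
    (by simp [hc]) F N
  rw [h]
  simp [sub_eq_add_neg]

end DifferentialOperators

section ArcDerivative

/-- The derivation `(1 - 2x + 2x²) d/dx`, i.e. differentiation with respect to the angle `φ` for
which `tan φ = x / (1 - x)`. -/
noncomputable def angleDeriv : Derivation ℝ (PowerSeries ℝ) (PowerSeries ℝ) :=
  (1 - 2 * PowerSeries.X + 2 * PowerSeries.X ^ 2 : PowerSeries ℝ) • PowerSeries.derivative ℝ

/-- `tan φ`. -/
noncomputable def tanSeries : PowerSeries ℝ := PowerSeries.X * (1 - PowerSeries.X)⁻¹

/-- `tan (φ + π / 4)`. -/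
noncomputable def tanShiftSeries : PowerSeries ℝ := (1 - 2 * PowerSeries.X)⁻¹

/-- `cos (2 φ)`. -/
noncomputable def cosSeries : PowerSeries ℝ :=
  (1 - 2 * PowerSeries.X) * (1 - 2 * PowerSeries.X + 2 * PowerSeries.X ^ 2)⁻¹

/-- `sin (2 φ)`. -/
noncomputable def sinSeries : PowerSeries ℝ :=
  2 * PowerSeries.X * (1 - PowerSeries.X) * (1 - 2 * PowerSeries.X + 2 * PowerSeries.X ^ 2)⁻¹

lemma one_sub_X_mul_inv : (1 - PowerSeries.X : PowerSeries ℝ) * (1 - PowerSeries.X)⁻¹ = 1 :=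
  PowerSeries.mul_inv_cancel _ (by simp)

lemma one_sub_two_mul_X_mul_inv :
    (1 - 2 * PowerSeries.X : PowerSeries ℝ) * (1 - 2 * PowerSeries.X)⁻¹ = 1 :=
  PowerSeries.mul_inv_cancel _ (by simp)

lemma angle_jacobian_mul_inv :
    (1 - 2 * PowerSeries.X + 2 * PowerSeries.X ^ 2 : PowerSeries ℝ) *
      (1 - 2 * PowerSeries.X + 2 * PowerSeries.X ^ 2)⁻¹ = 1 :=
  PowerSeries.mul_inv_cancel _ (by simp)

lemma angleDeriv_apply (F : PowerSeries ℝ) :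
    angleDeriv F =
      (1 - 2 * PowerSeries.X + 2 * PowerSeries.X ^ 2) * PowerSeries.derivative ℝ F := rfl

lemma derivative_two_mul_X :
    PowerSeries.derivative ℝ (2 * PowerSeries.X) = (2 : PowerSeries ℝ) := by
  rw [two_mul, map_add, PowerSeries.derivative_X, one_add_one_eq_two]

lemma derivative_angle_jacobian :
    PowerSeries.derivative ℝ (1 - 2 * PowerSeries.X + 2 * PowerSeries.X ^ 2) =
      (-2 + 4 * PowerSeries.X : PowerSeries ℝ) := by
  rw [sq, ← mul_assoc, map_add, map_sub, PowerSeries.derivative_one, derivative_two_mul_X,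
    Derivation.leibniz, derivative_two_mul_X, PowerSeries.derivative_X]
  simp only [smul_eq_mul]
  ring

lemma angleDeriv_tanSeries : angleDeriv tanSeries = 1 + tanSeries ^ 2 := by
  have h := one_sub_X_mul_inv
  rw [angleDeriv_apply, tanSeries, Derivation.leibniz, PowerSeries.derivative_inv', map_sub,
    PowerSeries.derivative_one, PowerSeries.derivative_X]
  simp only [smul_eq_mul]
  generalize (1 - PowerSeries.X : PowerSeries ℝ)⁻¹ = a at *
  linear_combination (-(1 - 2 * PowerSeries.X + 2 * PowerSeries.X ^ 2) * a
    + (1 - PowerSeries.X) * a + 1) * h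

lemma angleDeriv_tanShiftSeries : angleDeriv tanShiftSeries = 1 + tanShiftSeries ^ 2 := by
  have h := one_sub_two_mul_X_mul_inv
  rw [angleDeriv_apply, tanShiftSeries, PowerSeries.derivative_inv', map_sub,
    PowerSeries.derivative_one, derivative_two_mul_X]
  generalize (1 - 2 * PowerSeries.X : PowerSeries ℝ)⁻¹ = a at *
  linear_combination ((1 - 2 * PowerSeries.X) * a + 1) * h

lemma angleDeriv_cosSeries : angleDeriv cosSeries = -(2 : ℝ) • sinSeries := by
  have h := angle_jacobian_mul_inv
  rw [neg_smul, ofNat_smul_eq_nsmul, nsmul_eq_mul, angleDeriv_apply, cosSeries, sinSeries,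
    Derivation.leibniz, PowerSeries.derivative_inv', derivative_angle_jacobian, map_sub,
    PowerSeries.derivative_one, derivative_two_mul_X]
  simp only [smul_eq_mul]
  generalize (1 - 2 * PowerSeries.X + 2 * PowerSeries.X ^ 2 : PowerSeries ℝ)⁻¹ = v at *
  push_cast
  linear_combination 2 * (1 - 2 * PowerSeries.X) ^ 2 * v * h

lemma angleDeriv_sinSeries : angleDeriv sinSeries = (2 : ℝ) • cosSeries := by
  have h := angle_jacobian_mul_inv
  rw [ofNat_smul_eq_nsmul, nsmul_eq_mul, angleDeriv_apply, cosSeries, sinSeries,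
    Derivation.leibniz, PowerSeries.derivative_inv', derivative_angle_jacobian,
    Derivation.leibniz, map_sub, PowerSeries.derivative_one, derivative_two_mul_X,
    PowerSeries.derivative_X]
  simp only [smul_eq_mul]
  generalize (1 - 2 * PowerSeries.X + 2 * PowerSeries.X ^ 2 : PowerSeries ℝ)⁻¹ = v at *
  push_cast
  linear_combination
    4 * PowerSeries.X * (1 - PowerSeries.X) * (1 - 2 * PowerSeries.X) * v * h

lemma cosSeries_mul_tanShiftSeries : cosSeries * tanShiftSeries = 1 + sinSeries := by
  have h := one_sub_two_mul_X_mul_inv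
  have h' := angle_jacobian_mul_inv
  rw [cosSeries, sinSeries, tanShiftSeries]
  linear_combination (1 - 2 * PowerSeries.X + 2 * PowerSeries.X ^ 2 : PowerSeries ℝ)⁻¹ * h + h'

lemma sinSeries_mul_tanSeries : sinSeries * tanSeries = 1 - cosSeries := by
  have h := one_sub_X_mul_inv
  have h' := angle_jacobian_mul_inv
  rw [cosSeries, sinSeries, tanSeries]
  linear_combination
    2 * PowerSeries.X ^ 2 * (1 - 2 * PowerSeries.X + 2 * PowerSeries.X ^ 2 : PowerSeries ℝ)⁻¹ * h
      + h'

lemma cosSeries_sq_add_sinSeries_sq : cosSeries ^ 2 + sinSeries ^ 2 = 1 := by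
  have h' := angle_jacobian_mul_inv
  rw [cosSeries, sinSeries]
  linear_combination ((1 - 2 * PowerSeries.X + 2 * PowerSeries.X ^ 2 : PowerSeries ℝ) *
      (1 - 2 * PowerSeries.X + 2 * PowerSeries.X ^ 2)⁻¹ + 1) * h'

lemma constantCoeff_cosSeries : PowerSeries.constantCoeff cosSeries = 1 := by
  simp [cosSeries]

lemma constantCoeff_sinSeries : PowerSeries.constantCoeff sinSeries = 0 := by
  simp [sinSeries]

lemma constantCoeff_tanSeries : PowerSeries.constantCoeff tanSeries = 0 := by
  simp [tanSeries]

end ArcDerivative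

section OddFunctions

variable {A : Type*} [CommRing A] [Algebra ℝ A]

/-- The odd polynomial `x p(x²)` evaluated at `x`. -/
noncomputable def oddEval (x : A) (p : ℝ[X]) : A := x * aeval (x ^ 2) p

/-- The action of the square of `(1 + x²) d/dx` on odd polynomials `x p(x²)`. -/
noncomputable def tanOp (p : ℝ[X]) : ℝ[X] :=
  2 * (1 + X) * derivative ((1 + X) * (p + 2 * X * derivative p))

lemma oddEval_add (x : A) (p q : ℝ[X]) : oddEval x (p + q) = oddEval x p + oddEval x q := by
  simp [oddEval, mul_add]

lemma oddEval_smul (x : A) (r : ℝ) (p : ℝ[X]) : oddEval x (r • p) = r • oddEval x p := by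
  simp [oddEval]

lemma derivation_oddEval {D : Derivation ℝ A A} {x : A} (hx : D x = 1 + x ^ 2) (p : ℝ[X]) :
    D (D (oddEval x p)) = oddEval x (tanOp p) := by
  have key (q : ℝ[X]) :
      D (aeval (x ^ 2) q) = aeval (x ^ 2) (derivative q) * (2 * x * (1 + x ^ 2)) := by
    rw [Derivation.map_aeval, sq x, Derivation.leibniz, hx]
    simp only [smul_eq_mul]
    ring
  have h1 : D (oddEval x p) = aeval (x ^ 2) ((1 + X) * (p + 2 * X * derivative p)) := by
    rw [oddEval, Derivation.leibniz, key, hx]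
    simp only [smul_eq_mul, map_add, map_mul, map_one, aeval_X, map_ofNat]
    ring
  rw [h1, key, oddEval, tanOp]
  simp only [map_add, map_mul, map_one, aeval_X, map_ofNat]
  ring

/-- The algebra of even polynomials. -/
noncomputable def evenPoly : Subalgebra ℝ ℝ[X] := Algebra.adjoin ℝ {X ^ 2}

lemma X_sq_mem_evenPoly : (X ^ 2 : ℝ[X]) ∈ evenPoly := Algebra.subset_adjoin rfl

lemma X_sq_add_C_mem_evenPoly (r : ℝ) : (X ^ 2 + C r : ℝ[X]) ∈ evenPoly :=
  add_mem X_sq_mem_evenPoly (evenPoly.algebraMap_mem r)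

lemma evenProd_mem_evenPoly (r : ℝ) (N : ℕ) : evenProd r N ∈ evenPoly :=
  prod_mem fun _ _ => X_sq_add_C_mem_evenPoly _

lemma oddProd_mem_evenPoly (r : ℝ) (N : ℕ) : oddProd r N ∈ evenPoly :=
  prod_mem fun _ _ => X_sq_add_C_mem_evenPoly _

lemma exists_diffOp_oddEval {D : Derivation ℝ A A} {x : A} (hx : D x = 1 + x ^ 2) {p : ℝ[X]}
    (hp : p ∈ evenPoly) (q : ℝ[X]) : ∃ q', diffOp D p (oddEval x q) = oddEval x q' := by
  induction hp using Algebra.adjoin_induction generalizing q with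
  | mem p hp =>
    rw [Set.mem_singleton_iff] at hp
    exact ⟨tanOp q, by rw [hp, sq X, diffOp_X_mul, diffOp_X, derivation_oddEval hx]⟩
  | algebraMap r => exact ⟨r • q, by rw [oddEval_smul]; exact diffOp_C D r _⟩
  | add p p' _ _ ih ih' =>
    obtain ⟨a, ha⟩ := ih q
    obtain ⟨b, hb⟩ := ih' q
    exact ⟨a + b, by rw [diffOp_add, ha, hb, oddEval_add]⟩
  | mul p p' _ _ ih ih' =>
    obtain ⟨b, hb⟩ := ih' q
    obtain ⟨a, ha⟩ := ih b
    exact ⟨a, by rw [diffOp_mul, hb, ha]⟩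

end OddFunctions

section ConstantTerms

/-- The constant term of `p(∇) F`. -/
noncomputable def diffConst (p : ℝ[X]) (F : PowerSeries ℝ) : ℝ :=
  PowerSeries.constantCoeff (diffOp angleDeriv p F)

lemma diffConst_sub (p q : ℝ[X]) (F : PowerSeries ℝ) :
    diffConst (p - q) F = diffConst p F - diffConst q F := by
  simp [diffConst, diffOp_sub]

lemma diffConst_C_mul (r : ℝ) (p : ℝ[X]) (F : PowerSeries ℝ) :
    diffConst (C r * p) F = r * diffConst p F := by
  simp [diffConst, diffOp_C_mul]

lemma diffConst_tanSeries_eq_zero {p : ℝ[X]} (hp : p ∈ evenPoly) :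
    diffConst p tanSeries = 0 := by
  obtain ⟨q, hq⟩ := exists_diffOp_oddEval angleDeriv_tanSeries hp 1
  rw [diffConst, show tanSeries = oddEval tanSeries 1 by simp [oddEval], hq, oddEval, map_mul,
    constantCoeff_tanSeries, zero_mul]

lemma angleDeriv_sq_cosSeries : angleDeriv (angleDeriv cosSeries) = -((2 : ℝ) ^ 2) • cosSeries := by
  rw [angleDeriv_cosSeries, Derivation.map_smul, angleDeriv_sinSeries]
  module

lemma angleDeriv_sq_sinSeries : angleDeriv (angleDeriv sinSeries) = -((2 : ℝ) ^ 2) • sinSeries := by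
  rw [angleDeriv_sinSeries, Derivation.map_smul, angleDeriv_cosSeries]
  module

lemma diffConst_evenProd_tanShiftSeries (N : ℕ) :
    diffConst (X ^ 2 * evenProd 4 N) tanShiftSeries
      = ∏ j ∈ range (N + 1), ((2 : ℝ) * (2 * j + 1)) ^ 2 := by
  have h := diffOp_oddProd_mul_cos angleDeriv (w := 2) angleDeriv_cosSeries angleDeriv_sinSeries
    tanShiftSeries N
  rw [cosSeries_mul_tanShiftSeries, map_add, oddProd_diffOp_eq_zero _ angleDeriv_sq_sinSeries,
    oddProd_diffOp_eq_smul angleDeriv (w := 0) (by simp)] at h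
  have h' := congrArg PowerSeries.constantCoeff h
  simp only [sub_zero, ne_eq, OfNat.ofNat_ne_zero, not_false_eq_true, zero_pow, add_zero,
    map_sub, map_mul, PowerSeries.constantCoeff_smul, map_one, constantCoeff_cosSeries,
    constantCoeff_sinSeries, zero_mul, one_mul, smul_eq_mul, mul_one] at h'
  rw [h', diffConst]
  norm_num

/-- `tan φ + tan (φ + π / 4)`. -/
noncomputable def tanSumSeries : PowerSeries ℝ := tanSeries + tanShiftSeries

lemma diffConst_evenProd_tanSumSeries (N : ℕ) :
    8 * (N + 1) * diffConst (X * evenProd 8 N) tanSumSeries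
      = 2 * ∏ j ∈ range (N + 1), (((4 : ℝ) * (2 * j + 1)) ^ 2 - 2 ^ 2) := by
  set c4 := 2 * cosSeries ^ 2 - 1 with hc4
  set s4 := 2 * sinSeries * cosSeries with hs4
  have key : cosSeries ^ 2 + sinSeries ^ 2 = 1 := cosSeries_sq_add_sinSeries_sq
  have h2 (F : PowerSeries ℝ) : (2 : ℝ) • F = F + F := two_smul _ _
  have h4 (F : PowerSeries ℝ) : (4 : ℝ) • F = F + F + (F + F) := by module
  have d2 (F : PowerSeries ℝ) : angleDeriv (2 * F) = 2 * angleDeriv F := by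
    rw [two_mul, map_add, two_mul]
  have hc : angleDeriv c4 = -(4 : ℝ) • s4 := by
    rw [hc4, hs4, map_sub, d2, sq, Derivation.leibniz, angleDeriv_cosSeries,
      Derivation.map_one_eq_zero, neg_smul, neg_smul, h2, h4]
    simp only [smul_eq_mul]
    ring
  have hs : angleDeriv s4 = (4 : ℝ) • c4 := by
    rw [hc4, hs4, mul_assoc, d2, Derivation.leibniz, angleDeriv_cosSeries, angleDeriv_sinSeries,
      neg_smul, h2, h2, h4]
    simp only [smul_eq_mul]
    linear_combination (-4) * key
  have hsum : s4 * tanSumSeries = (2 : ℝ) • sinSeries + (2 : ℝ) • cosSeries - (2 : ℝ) • c4 := by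
    rw [tanSumSeries, h2, h2, h2, hc4, hs4]
    linear_combination 2 * sinSeries * cosSeries_mul_tanShiftSeries
      + 2 * cosSeries * sinSeries_mul_tanSeries + 2 * key
  have hcc : angleDeriv (angleDeriv c4) = -((4 : ℝ) ^ 2) • c4 := by
    rw [hc, Derivation.map_smul, hs]
    module
  have h := diffOp_oddProd_mul_sin angleDeriv (w := 4) hc hs tanSumSeries N
  rw [hsum, map_sub, map_add, map_smul, map_smul, map_smul, oddProd_diffOp_eq_zero _ hcc,
    oddProd_diffOp_eq_smul _ angleDeriv_sq_sinSeries,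
    oddProd_diffOp_eq_smul _ angleDeriv_sq_cosSeries] at h
  have h' := congrArg PowerSeries.constantCoeff h
  have e1 : PowerSeries.constantCoeff s4 = 0 := by simp [hs4, constantCoeff_sinSeries]
  have e2 : PowerSeries.constantCoeff c4 = 1 := by
    rw [hc4, two_mul]
    simp [constantCoeff_cosSeries]
  simp only [map_add, map_mul, PowerSeries.constantCoeff_smul, constantCoeff_cosSeries,
    constantCoeff_sinSeries, e1, e2, smul_zero, smul_eq_mul, mul_one, mul_zero, zero_add,
    sub_zero, zero_mul, one_mul] at h'
  rw [h', show (2 : ℝ) * 4 = 8 by norm_num, diffConst]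
  ring

end ConstantTerms

section ClosedForms

/-- The row factors of the Cauchy-like matrix of constant terms. -/
noncomputable def rowFactor (k : ℕ) : ℝ := ∏ j ∈ range k, (4 * (4 * (j : ℝ) + 5) * (4 * j + 7))

/-- The column factors of the Cauchy-like matrix of constant terms. -/
noncomputable def colFactor (l : ℕ) : ℝ := 6 * ∏ j ∈ range l, (4 * (j : ℝ) + 6)

lemma rowFactor_zero : rowFactor 0 = 1 := by simp [rowFactor]

lemma rowFactor_succ (k : ℕ) :
    rowFactor (k + 1) = rowFactor k * (4 * (4 * (k : ℝ) + 5) * (4 * k + 7)) := by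
  rw [rowFactor, prod_range_succ, ← rowFactor]

lemma colFactor_zero : colFactor 0 = 6 := by simp [colFactor]

lemma colFactor_succ (l : ℕ) : colFactor (l + 1) = colFactor l * (4 * (l : ℝ) + 6) := by
  rw [colFactor, prod_range_succ, ← mul_assoc, ← colFactor]

lemma colFactor_two_mul_succ (m : ℕ) :
    colFactor (2 * (m + 1)) = colFactor (2 * m) * (4 * (4 * (m : ℝ) + 3) * (4 * m + 5)) := by
  rw [mul_add_one, colFactor_succ, colFactor_succ]
  push_cast
  ring

lemma colFactor_two_mul_add_one (m : ℕ) : colFactor (2 * m + 1) = 36 * rowFactor m := by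
  induction m with
  | zero => rw [rowFactor_zero, colFactor_succ, colFactor_zero]; norm_num
  | succ m ih =>
    rw [mul_add_one, colFactor_succ, colFactor_succ, ih, rowFactor_succ]
    push_cast
    ring

/-- A predicate on `ℕ × ℕ` follows from its values at `(k, k)` and `(k, k + 1)` when it propagates
across triangles `(k, m), (k + 1, m), (k, m + 1)`. -/
lemma forall_of_diagonal {P : ℕ → ℕ → Prop} (h0 : ∀ k, P k k) (h1 : ∀ k, P k (k + 1))
    (hr : ∀ k m, P (k + 1) m → P k m → P k (m + 1))
    (hl : ∀ k m, P k (m + 1) → P k m → P (k + 1) m) (k m : ℕ) : P k m := by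
  induction h : (4 * ((k : ℤ) - m) + 1).natAbs using Nat.strong_induction_on generalizing k m with
  | _ d ih =>
    rcases lt_trichotomy k m with hkm | rfl | hkm
    · obtain ⟨m, rfl⟩ : ∃ m', m = m' + 1 := ⟨m - 1, by omega⟩
      rcases (Nat.lt_succ_iff.mp hkm).eq_or_lt with rfl | hkm'
      · exact h1 k
      · exact hr k m (ih _ (by push_cast at h ⊢; omega) _ _ rfl)
          (ih _ (by push_cast at h ⊢; omega) _ _ rfl)
    · exact h0 k
    · obtain ⟨k, rfl⟩ : ∃ k', k = k' + 1 := ⟨k - 1, by omega⟩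
      exact hl k m (ih _ (by push_cast at h ⊢; omega) _ _ rfl)
        (ih _ (by push_cast at h ⊢; omega) _ _ rfl)

lemma prod_sq_eq_rowFactor_mul_colFactor (k : ℕ) :
    (4 * (k : ℝ) + 3) * ∏ j ∈ range (2 * k + 1), ((2 : ℝ) * (2 * j + 1)) ^ 2
      = 2 * rowFactor k * colFactor (2 * k) := by
  induction k with
  | zero => simp [rowFactor_zero, colFactor_zero]; norm_num
  | succ k ih =>
    rw [rowFactor_succ, colFactor_two_mul_succ, mul_add_one, prod_range_succ, prod_range_succ]
    push_cast
    linear_combination 16 * (4 * (k : ℝ) + 5) ^ 2 * (4 * k + 7) * (4 * k + 3) * ih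

lemma diffConst_tanShiftSeries_recursion (k m : ℕ) :
    diffConst (X ^ 2 * (evenProd 8 (k + 1) * oddProd 4 m)) tanShiftSeries
      - diffConst (X ^ 2 * (evenProd 8 k * oddProd 4 (m + 1))) tanShiftSeries
      = 16 * (2 * k + 2 * m + 3) * (2 * k - 2 * m + 1)
        * diffConst (X ^ 2 * (evenProd 8 k * oddProd 4 m)) tanShiftSeries := by
  rw [← diffConst_sub, ← diffConst_C_mul]
  congr 1
  rw [evenProd_succ, oddProd_succ]
  have : (C (16 * (2 * k + 2 * m + 3) * (2 * k - 2 * m + 1)) : ℝ[X])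
      = C ((8 * ((k : ℝ) + 1)) ^ 2) - C ((4 * (2 * (m : ℝ) + 1)) ^ 2) := by
    rw [← C_sub]
    congr 1
    ring
  rw [this]
  ring

lemma diffConst_tanShiftSeries (k m : ℕ) :
    (2 * k + 2 * m + 3) * diffConst (X ^ 2 * (evenProd 8 k * oddProd 4 m)) tanShiftSeries
      = 2 * rowFactor k * colFactor (2 * m) := by
  have e8 : (8 : ℝ) = 2 * 4 := by norm_num
  refine forall_of_diagonal (P := fun k m => (2 * (k : ℝ) + 2 * m + 3) *
    diffConst (X ^ 2 * (evenProd 8 k * oddProd 4 m)) tanShiftSeries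
      = 2 * rowFactor k * colFactor (2 * m)) ?_ ?_ ?_ ?_ k m
  · intro k
    rw [e8, ← evenProd_two_mul, diffConst_evenProd_tanShiftSeries,
      ← prod_sq_eq_rowFactor_mul_colFactor]
    ring
  · intro k
    rw [e8, ← evenProd_two_mul_add_one, diffConst_evenProd_tanShiftSeries, prod_range_succ,
      colFactor_two_mul_succ]
    push_cast
    linear_combination (4 * (4 * (k : ℝ) + 3) * (4 * k + 5))
      * prod_sq_eq_rowFactor_mul_colFactor k
  · intro k m h1 h2
    have h := diffConst_tanShiftSeries_recursion k m
    rw [rowFactor_succ] at h1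
    rw [colFactor_two_mul_succ]
    push_cast at h1 ⊢
    linear_combination h1 - (2 * k + 2 * m + 5) * h
      - (2 * k + 2 * m + 5) * 16 * (2 * k - 2 * m + 1) * h2
  · intro k m h1 h2
    have h := diffConst_tanShiftSeries_recursion k m
    rw [colFactor_two_mul_succ] at h1
    rw [rowFactor_succ]
    push_cast at h1 ⊢
    linear_combination h1 + (2 * k + 2 * m + 5) * h
      + (2 * k + 2 * m + 5) * 16 * (2 * k - 2 * m + 1) * h2

lemma diffConst_X_mul_evenProd (N : ℕ) :
    (N + 1) * diffConst (X * evenProd 8 N) tanSumSeries = 3 * rowFactor N := by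
  have h : ∏ j ∈ range (N + 1), (((4 : ℝ) * (2 * j + 1)) ^ 2 - 2 ^ 2) = 12 * rowFactor N := by
    rw [prod_range_succ', rowFactor, mul_comm]
    congr 1
    · norm_num
    · refine prod_congr rfl fun j _ => ?_
      push_cast
      ring
  linear_combination (diffConst_evenProd_tanSumSeries N + 2 * h) / 8

lemma diffConst_tanSumSeries (k m : ℕ) :
    (2 * k + 2 * m + 4) * diffConst (X ^ 3 * (evenProd 8 k * evenProd 8 m)) tanSumSeries
      = 2 * rowFactor k * colFactor (2 * m + 1) := by
  induction m generalizing k with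
  | zero =>
    have h : diffConst (X ^ 3 * (evenProd 8 k * evenProd 8 0)) tanSumSeries
        = diffConst (X * evenProd 8 (k + 1)) tanSumSeries
          - (8 * (k + 1)) ^ 2 * diffConst (X * evenProd 8 k) tanSumSeries := by
      rw [← diffConst_C_mul, ← diffConst_sub, evenProd_zero, evenProd_succ]
      congr 1
      ring
    have h1 := diffConst_X_mul_evenProd (k + 1)
    have h2 := diffConst_X_mul_evenProd k
    rw [rowFactor_succ] at h1
    rw [h, colFactor_two_mul_add_one, rowFactor_zero]
    push_cast at h1 ⊢
    linear_combination 2 * h1 - 128 * (k + 2) * (k + 1) * h2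
  | succ m ih =>
    have h : diffConst (X ^ 3 * (evenProd 8 k * evenProd 8 (m + 1))) tanSumSeries
        = diffConst (X ^ 3 * (evenProd 8 (k + 1) * evenProd 8 m)) tanSumSeries
          - 64 * (k - m) * (k + m + 2)
            * diffConst (X ^ 3 * (evenProd 8 k * evenProd 8 m)) tanSumSeries := by
      rw [← diffConst_C_mul, ← diffConst_sub, evenProd_succ, evenProd_succ]
      have : (C (64 * (k - m) * (k + m + 2)) : ℝ[X])
          = C ((8 * ((k : ℝ) + 1)) ^ 2) - C ((8 * ((m : ℝ) + 1)) ^ 2) := by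
        rw [← C_sub]
        congr 1
        ring
      rw [this]
      congr 1
      ring
    have h1 := ih (k + 1)
    have h2 := ih k
    rw [colFactor_two_mul_add_one] at h1 h2 ⊢
    rw [rowFactor_succ] at h1 ⊢
    rw [h]
    push_cast at h1 ⊢
    linear_combination h1 - 64 * (k - m) * (k + m + 3) * h2

/-- Monic polynomials of degree `l`, alternating in parity. -/
noncomputable def colPoly (l : ℕ) : ℝ[X] :=
  if Even l then oddProd 4 (l / 2) else X * evenProd 8 (l / 2)

lemma colPoly_two_mul (m : ℕ) : colPoly (2 * m) = oddProd 4 m := by simp [colPoly]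

lemma colPoly_two_mul_add_one (m : ℕ) : colPoly (2 * m + 1) = X * evenProd 8 m := by
  rw [colPoly, if_neg (by simp), show (2 * m + 1) / 2 = m by omega]

/-- The series `(1 + t²) t^(2i+1) + (1 + s²) s^(2i+1)` for `t = tan φ` and
`s = tan (φ + π / 4)`. -/
noncomputable def tanRow (i : ℕ) : PowerSeries ℝ :=
  (1 + tanSeries ^ 2) * tanSeries ^ (2 * i + 1)
    + (1 + tanShiftSeries ^ 2) * tanShiftSeries ^ (2 * i + 1)

lemma diffOp_X_sq_tanSumSeries : diffOp angleDeriv (X ^ 2) tanSumSeries = (2 : ℝ) • tanRow 0 := by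
  rw [sq, diffOp_X_mul, diffOp_X, tanSumSeries, map_add, angleDeriv_tanSeries,
    angleDeriv_tanShiftSeries, sq, sq, map_add, map_add, map_add, Derivation.leibniz,
    Derivation.leibniz, angleDeriv_tanSeries, angleDeriv_tanShiftSeries,
    Derivation.map_one_eq_zero, two_smul, tanRow]
  simp only [smul_eq_mul]
  ring

lemma diffConst_tanRow_zero (k l : ℕ) :
    (2 * k + l + 3) * diffConst (colPoly l * evenProd 8 k) (tanRow 0)
      = rowFactor k * colFactor l := by
  have h (p : ℝ[X]) : diffConst (X ^ 2 * p) tanSumSeries = 2 * diffConst p (tanRow 0) := by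
    rw [mul_comm, diffConst, diffOp_mul, diffOp_X_sq_tanSumSeries, map_smul, diffConst,
      PowerSeries.constantCoeff_smul, smul_eq_mul]
  obtain ⟨m, rfl | rfl⟩ := Nat.even_or_odd' l
  · have h1 := diffConst_tanShiftSeries k m
    have h2 : diffConst (X ^ 2 * (evenProd 8 k * oddProd 4 m)) tanSeries = 0 :=
      diffConst_tanSeries_eq_zero (mul_mem X_sq_mem_evenPoly
        (mul_mem (evenProd_mem_evenPoly _ _) (oddProd_mem_evenPoly _ _)))
    have h3 := h (evenProd 8 k * oddProd 4 m)
    rw [tanSumSeries, diffConst, map_add, map_add, ← diffConst, ← diffConst, h2] at h3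
    rw [colPoly_two_mul, mul_comm (oddProd _ _)]
    push_cast
    linear_combination h1 / 2 - (2 * k + 2 * m + 3) / 2 * h3
  · have h1 := diffConst_tanSumSeries k m
    have h3 := h (X * (evenProd 8 k * evenProd 8 m))
    rw [← mul_assoc, ← pow_succ] at h3
    rw [colPoly_two_mul_add_one, mul_assoc, mul_comm (evenProd 8 m)]
    push_cast
    linear_combination h1 / 2 - (2 * k + 2 * m + 4) / 2 * h3

end ClosedForms

section RowPolynomials

/-- The conjugate of `tanOp` by multiplication by `1 + X`. -/
noncomputable def rowOp (p : ℝ[X]) : ℝ[X] :=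
  2 * derivative ((1 + 4 * X + 3 * X ^ 2) * p + 2 * (X + 2 * X ^ 2 + X ^ 3) * derivative p)

lemma tanOp_one_add_X_mul (p : ℝ[X]) : tanOp ((1 + X) * p) = (1 + X) * rowOp p := by
  rw [tanOp, rowOp, mul_comm 2, mul_assoc]
  congr 3
  simp only [derivative_mul, derivative_add, derivative_one, derivative_X]
  ring

lemma coeff_rowOp_succ (p : ℝ[X]) (j : ℕ) :
    (rowOp p).coeff (j + 1) = 2 * (j + 2) * ((2 * j + 5) * p.coeff (j + 2)
      + (4 * j + 8) * p.coeff (j + 1) + (2 * j + 3) * p.coeff j) := by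
  have h : (1 + 4 * X + 3 * X ^ 2) * p + 2 * (X + 2 * X ^ 2 + X ^ 3) * derivative p
      = p + C 4 * (X * p) + C 3 * (X ^ 2 * p) + C 2 * (X * derivative p)
        + C 4 * (X ^ 2 * derivative p) + C 2 * (X ^ 2 * (X * derivative p)) := by
    simp only [map_ofNat]
    ring
  have hX : (X * derivative p).coeff j = j * p.coeff j := by
    cases j <;> simp [coeff_derivative]; ring
  rw [rowOp, h, ← map_ofNat C 2, coeff_C_mul, coeff_derivative]
  simp only [coeff_add, coeff_C_mul, coeff_X_mul, coeff_X_pow_mul, hX, coeff_derivative]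
  push_cast
  ring

/-- The polynomials expressing `∏ (∇² + (8 (j + 1))²)` applied to `tanRow 0` through `tanRow`. -/
noncomputable def rowPoly : ℕ → ℝ[X]
  | 0 => 1
  | k + 1 => rowOp (rowPoly k) + C ((8 * ((k : ℝ) + 1)) ^ 2) * rowPoly k

lemma coeff_rowPoly_eq_zero {k j : ℕ} (h : k < j) : (rowPoly k).coeff j = 0 := by
  induction k generalizing j with
  | zero => rw [rowPoly, coeff_one, if_neg (by omega)]
  | succ k ih =>
    obtain ⟨j, rfl⟩ : ∃ j', j = j' + 1 := ⟨j - 1, by omega⟩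
    rw [rowPoly, coeff_add, coeff_C_mul, coeff_rowOp_succ, ih (by omega), ih (by omega),
      ih (by omega)]
    ring

lemma coeff_rowPoly_self (k : ℕ) : (rowPoly k).coeff k = (2 * k + 2).factorial / 2 := by
  induction k with
  | zero => simp [rowPoly]
  | succ k ih =>
    rw [rowPoly, coeff_add, coeff_C_mul, coeff_rowOp_succ, coeff_rowPoly_eq_zero (by omega),
      coeff_rowPoly_eq_zero (by omega), ih, show 2 * (k + 1) + 2 = 2 * k + 2 + 1 + 1 by ring,
      Nat.factorial_succ (2 * k + 2 + 1), Nat.factorial_succ (2 * k + 2)]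
    push_cast
    ring

lemma diffOp_evenProd_oddEval {A : Type*} [CommRing A] [Algebra ℝ A] {D : Derivation ℝ A A}
    {x : A} (hx : D x = 1 + x ^ 2) (k : ℕ) :
    diffOp D (evenProd 8 k) (oddEval x (1 + X)) = oddEval x ((1 + X) * rowPoly k) := by
  induction k with
  | zero => rw [evenProd_zero, diffOp_one, rowPoly, mul_one]
  | succ k ih =>
    rw [evenProd_succ, diffOp_mul, ih, diffOp_sq_add_C, derivation_oddEval hx,
      tanOp_one_add_X_mul, ← oddEval_smul, ← oddEval_add, rowPoly, ← C_mul']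
    congr 1
    ring

lemma oddEval_one_add_X_mul {A : Type*} [CommRing A] [Algebra ℝ A] (x : A) (k : ℕ) :
    oddEval x ((1 + X) * rowPoly k) =
      ∑ i ∈ range (k + 1), (rowPoly k).coeff i • ((1 + x ^ 2) * x ^ (2 * i + 1)) := by
  have h : aeval (x ^ 2) (rowPoly k)
      = ∑ i ∈ range (k + 1), (rowPoly k).coeff i • (x ^ 2) ^ i :=
    aeval_eq_sum_range' (Nat.lt_succ_of_le (natDegree_le_iff_coeff_eq_zero.mpr
      fun _ => coeff_rowPoly_eq_zero)) _
  rw [oddEval, map_mul, map_add, map_one, aeval_X, h, mul_sum, mul_sum]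
  refine sum_congr rfl fun i _ => ?_
  rw [mul_smul_comm, mul_smul_comm]
  congr 1
  ring

lemma diffOp_evenProd_tanRow_zero (k : ℕ) :
    diffOp angleDeriv (evenProd 8 k) (tanRow 0)
      = ∑ i ∈ range (k + 1), (rowPoly k).coeff i • tanRow i := by
  have h (x : PowerSeries ℝ) : (1 + x ^ 2) * x ^ (2 * 0 + 1) = oddEval x (1 + X) := by
    simp only [oddEval, map_add, map_one, aeval_X]
    ring
  simp only [tanRow, smul_add]
  rw [h, h, map_add, diffOp_evenProd_oddEval angleDeriv_tanSeries,
    diffOp_evenProd_oddEval angleDeriv_tanShiftSeries, oddEval_one_add_X_mul,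
    oddEval_one_add_X_mul, sum_add_distrib]

end RowPolynomials

section ColumnExpansion

lemma diffConst_X_pow (m j : ℕ) (h : m ≤ j) (G : PowerSeries ℝ) :
    diffConst (X ^ m) (PowerSeries.X ^ j * G)
      = if m = j then j.factorial * PowerSeries.constantCoeff G else 0 := by
  induction m generalizing j G with
  | zero =>
    rw [pow_zero, diffConst, diffOp_one]
    cases j <;> simp
  | succ m ih =>
    obtain ⟨j, rfl⟩ : ∃ j', j = j' + 1 := ⟨j - 1, by omega⟩
    have hd : angleDeriv (PowerSeries.X ^ (j + 1) * G) = PowerSeries.X ^ j *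
        ((j + 1 : ℕ) • ((1 - 2 * PowerSeries.X + 2 * PowerSeries.X ^ 2) * G)
          + PowerSeries.X * angleDeriv G) := by
      rw [Derivation.leibniz, Derivation.leibniz_pow, angleDeriv_apply PowerSeries.X,
        PowerSeries.derivative_X]
      simp only [smul_eq_mul, nsmul_eq_mul, Nat.add_sub_cancel]
      ring
    rw [diffConst, diffOp_X_pow_succ, ← diffConst, hd, ih _ (by omega)]
    by_cases hmj : m = j
    · simp [hmj, Nat.factorial_succ]
      ring
    · simp [hmj]

lemma diffConst_X_pow_mul {p : ℝ[X]} {j : ℕ} (h : p.natDegree ≤ j) (G : PowerSeries ℝ) :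
    diffConst p (PowerSeries.X ^ j * G)
      = j.factorial * p.coeff j * PowerSeries.constantCoeff G := by
  have hp : diffConst p (PowerSeries.X ^ j * G)
      = ∑ m ∈ range (j + 1), p.coeff m * diffConst (X ^ m) (PowerSeries.X ^ j * G) := by
    conv_lhs => rw [p.as_sum_range_C_mul_X_pow' (Nat.lt_succ_of_le h)]
    simp only [diffConst, diffOp, map_sum, map_mul, aeval_C, LinearMap.sum_apply]
    refine sum_congr rfl fun m _ => ?_
    simp
  rw [hp, sum_range_succ, diffConst_X_pow _ _ le_rfl, if_pos rfl, sum_eq_zero, zero_add]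
  · ring
  · intro m hm
    rw [mem_range] at hm
    rw [diffConst_X_pow _ _ hm.le, if_neg hm.ne, mul_zero]

lemma diffConst_eq_sum {p : ℝ[X]} {n : ℕ} (h : p.natDegree < n) (U F : PowerSeries ℝ) :
    diffConst p (U * F) = ∑ j ∈ range n, PowerSeries.coeff j F
      * diffConst p (U * PowerSeries.X ^ j) := by
  have hlast : diffConst p (PowerSeries.X ^ n
      * (U * PowerSeries.mk fun i => PowerSeries.coeff (i + n) F)) = 0 := by
    rw [diffConst_X_pow_mul h.le, coeff_eq_zero_of_natDegree_lt h]
    ring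
  have hF : U * F = PowerSeries.X ^ n * (U * PowerSeries.mk fun i => PowerSeries.coeff (i + n) F)
      + ∑ j ∈ range n, PowerSeries.coeff j F • (U * PowerSeries.X ^ j) := by
    conv_lhs => rw [PowerSeries.eq_X_pow_mul_shift_add_trunc n F]
    rw [mul_add, mul_left_comm]
    congr 1
    rw [PowerSeries.trunc_apply, ← Nat.Ico_zero_eq_range]
    rw [← Polynomial.coeToPowerSeries.ringHom_apply, map_sum, mul_sum]
    refine sum_congr rfl fun j _ => ?_
    rw [Polynomial.coeToPowerSeries.ringHom_apply, Polynomial.coe_monomial,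
      PowerSeries.monomial_eq_C_mul_X_pow, PowerSeries.smul_eq_C_mul]
    ring
  rw [hF, diffConst, map_add, map_add, ← diffConst, hlast, zero_add, map_sum, map_sum]
  refine sum_congr rfl fun j _ => ?_
  rw [map_smul, PowerSeries.constantCoeff_smul, smul_eq_mul, diffConst]

end ColumnExpansion

section ColumnPolynomials

lemma evenProd_monic_natDegree (r : ℝ) (N : ℕ) :
    (evenProd r N).Monic ∧ (evenProd r N).natDegree = 2 * N := by
  induction N with
  | zero => simp [evenProd_zero]
  | succ N ih =>
    rw [evenProd_succ]
    refine ⟨(monic_X_pow_add_C _ two_ne_zero).mul ih.1, ?_⟩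
    rw [(monic_X_pow_add_C _ two_ne_zero).natDegree_mul ih.1, natDegree_X_pow_add_C, ih.2]
    ring

lemma oddProd_monic_natDegree (r : ℝ) (N : ℕ) :
    (oddProd r N).Monic ∧ (oddProd r N).natDegree = 2 * N := by
  induction N with
  | zero => simp [oddProd_zero]
  | succ N ih =>
    rw [oddProd_succ]
    refine ⟨(monic_X_pow_add_C _ two_ne_zero).mul ih.1, ?_⟩
    rw [(monic_X_pow_add_C _ two_ne_zero).natDegree_mul ih.1, natDegree_X_pow_add_C, ih.2]
    ring

lemma colPoly_monic_natDegree (l : ℕ) : (colPoly l).Monic ∧ (colPoly l).natDegree = l := by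
  obtain ⟨m, rfl | rfl⟩ := Nat.even_or_odd' l
  · rw [colPoly_two_mul]
    exact oddProd_monic_natDegree 4 m
  · have h := evenProd_monic_natDegree 8 m
    rw [colPoly_two_mul_add_one]
    exact ⟨monic_X.mul h.1, by rw [monic_X.natDegree_mul h.1, natDegree_X, h.2, add_comm]⟩

end ColumnPolynomials

section EntrySeries

/-- The entries of the matrix, with ordinary binomial coefficients. -/
noncomputable def entry (i j : ℕ) : ℝ :=
  2 ^ (j + 1) * ((2 * i + j + 2).choose (2 * i + 2) : ℝ) + ((j + 1).choose (2 * i + 2) : ℝ)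

lemma mk_entry (i : ℕ) : PowerSeries.mk (entry i) =
    2 * tanShiftSeries ^ (2 * i + 3)
      + PowerSeries.X ^ (2 * i + 1) * ((1 - PowerSeries.X)⁻¹) ^ (2 * i + 3) := by
  have h1 : ((1 - PowerSeries.X : PowerSeries ℝ)⁻¹) ^ (2 * i + 3)
      = PowerSeries.mk fun n => ((2 * i + 2 + n).choose (2 * i + 2) : ℝ) := by
    have h := PowerSeries.mk_add_choose_mul_one_sub_pow_eq_one ℝ (2 * i + 2)
    have h' : (1 - PowerSeries.X : PowerSeries ℝ) ^ (2 * i + 3)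
        * ((1 - PowerSeries.X)⁻¹) ^ (2 * i + 3) = 1 := by
      rw [← mul_pow, one_sub_X_mul_inv, one_pow]
    exact (left_inv_eq_right_inv h h').symm
  have h2 : tanShiftSeries ^ (2 * i + 3)
      = PowerSeries.mk fun n => (2 : ℝ) ^ n * ((2 * i + 2 + n).choose (2 * i + 2) : ℝ) := by
    have h := congrArg (PowerSeries.rescale (2 : ℝ))
      (PowerSeries.mk_add_choose_mul_one_sub_pow_eq_one ℝ (2 * i + 2))
    rw [map_mul, map_pow, map_sub, map_one, PowerSeries.rescale_X, map_ofNat] at h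
    have h' : (1 - 2 * PowerSeries.X : PowerSeries ℝ) ^ (2 * i + 3)
        * tanShiftSeries ^ (2 * i + 3) = 1 := by
      rw [← mul_pow, tanShiftSeries, one_sub_two_mul_X_mul_inv, one_pow]
    rw [← left_inv_eq_right_inv h h']
    ext n
    simp
  rw [h1, h2]
  ext j
  rw [map_add, PowerSeries.coeff_X_pow_mul', ← map_ofNat (PowerSeries.C (R := ℝ)) 2,
    PowerSeries.coeff_C_mul, PowerSeries.coeff_mk, PowerSeries.coeff_mk, PowerSeries.coeff_mk,
    entry, show 2 * i + j + 2 = 2 * i + 2 + j by ring]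
  split_ifs with hj
  · rw [show 2 * i + 2 + (j - (2 * i + 1)) = j + 1 by omega]
    ring
  · rw [Nat.choose_eq_zero_of_lt (by omega : j + 1 < 2 * i + 2)]
    push_cast
    ring

lemma jacobian_mul_mk_entry (i : ℕ) :
    (1 - 2 * PowerSeries.X + 2 * PowerSeries.X ^ 2) * PowerSeries.mk (entry i) = tanRow i := by
  have h1 : (1 + tanSeries ^ 2) = (1 - 2 * PowerSeries.X + 2 * PowerSeries.X ^ 2)
      * ((1 - PowerSeries.X)⁻¹) ^ 2 := by
    rw [tanSeries]
    linear_combination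
      -(1 + (1 - PowerSeries.X) * (1 - PowerSeries.X : PowerSeries ℝ)⁻¹) * one_sub_X_mul_inv
  have h2 : (1 + tanShiftSeries ^ 2) = 2 * (1 - 2 * PowerSeries.X + 2 * PowerSeries.X ^ 2)
      * tanShiftSeries ^ 2 := by
    have h := one_sub_two_mul_X_mul_inv
    rw [← tanShiftSeries] at h
    linear_combination -(1 + (1 - 2 * PowerSeries.X) * tanShiftSeries) * h
  rw [tanRow, h1, h2, mk_entry, tanSeries, mul_pow]
  ring

/-- The triangular matrix relating columns of `entry` to constant terms. -/
noncomputable def colCoeff (j l : ℕ) : ℝ :=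
  diffConst (colPoly l)
    ((1 - 2 * PowerSeries.X + 2 * PowerSeries.X ^ 2) * PowerSeries.X ^ j)

lemma colCoeff_eq_zero {j l : ℕ} (h : l < j) : colCoeff j l = 0 := by
  rw [colCoeff, mul_comm, diffConst_X_pow_mul (by rw [(colPoly_monic_natDegree l).2]; exact h.le),
    coeff_eq_zero_of_natDegree_lt (by rw [(colPoly_monic_natDegree l).2]; exact h)]
  ring

lemma colCoeff_self (l : ℕ) : colCoeff l l = l.factorial := by
  have h := colPoly_monic_natDegree l
  have hc : (colPoly l).coeff l = 1 := by
    rw [← h.1.coeff_natDegree, h.2]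
  rw [colCoeff, mul_comm, diffConst_X_pow_mul h.2.le, hc]
  simp

lemma diffConst_eq_sum_entry {n k l : ℕ} (hk : k < n) (hl : l < n) :
    diffConst (colPoly l * evenProd 8 k) (tanRow 0)
      = ∑ i ∈ range n, (rowPoly k).coeff i * ∑ j ∈ range n, entry i j * colCoeff j l := by
  have h (i : ℕ) : PowerSeries.constantCoeff (diffOp angleDeriv (colPoly l) (tanRow i))
      = ∑ j ∈ range n, entry i j * colCoeff j l := by
    rw [← diffConst, ← jacobian_mul_mk_entry,
      diffConst_eq_sum ((colPoly_monic_natDegree l).2.trans_lt hl)]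
    simp only [PowerSeries.coeff_mk, colCoeff]
  rw [diffConst, diffOp_mul, diffOp_evenProd_tanRow_zero, map_sum, map_sum]
  simp only [map_smul, PowerSeries.constantCoeff_smul, smul_eq_mul, h]
  refine sum_subset (range_subset_range.mpr hk) fun i _ hi => ?_
  rw [coeff_rowPoly_eq_zero (by simpa using hi), zero_mul]

/-- The transformed matrix is, up to row and column factors, a Cauchy matrix. -/
lemma det_entry_mul (n : ℕ) :
    (∏ k : Fin n, (((2 * (k : ℕ) + 2).factorial : ℝ) / 2))
      * (Matrix.of fun i j : Fin n => entry i j).det * ∏ l : Fin n, ((l : ℕ).factorial : ℝ)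
      = (∏ k : Fin n, rowFactor k) * (∏ l : Fin n, colFactor l)
        * (Matrix.of fun k l : Fin n => (1 / (2 * (k : ℕ) + (l : ℕ) + 3) : ℝ)).det := by
  set S : Matrix (Fin n) (Fin n) ℝ := Matrix.of fun k i => (rowPoly k).coeff i with hS
  set a : Matrix (Fin n) (Fin n) ℝ := Matrix.of fun i j => entry i j with ha
  set T : Matrix (Fin n) (Fin n) ℝ := Matrix.of fun j l => colCoeff j l with hT
  have hdS : S.det = ∏ k : Fin n, (((2 * (k : ℕ) + 2).factorial : ℝ) / 2) := by
    rw [Matrix.det_of_isLowerTriangular]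
    · exact prod_congr rfl fun k _ => coeff_rowPoly_self k
    · intro i j hij
      exact coeff_rowPoly_eq_zero hij
  have hdT : T.det = ∏ l : Fin n, ((l : ℕ).factorial : ℝ) := by
    rw [Matrix.det_of_isUpperTriangular]
    · exact prod_congr rfl fun l _ => colCoeff_self l
    · intro i j hij
      exact colCoeff_eq_zero hij
  rw [← hdS, ← hdT, mul_comm (∏ k : Fin n, rowFactor k), mul_assoc, mul_assoc,
    ← Matrix.det_mul_column, ← Matrix.det_mul_row, ← Matrix.det_mul, ← Matrix.det_mul]
  congr 1
  ext k l
  have h := diffConst_tanRow_zero k l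
  rw [diffConst_eq_sum_entry k.2 l.2] at h
  have h0 : (2 * (k : ℕ) + (l : ℕ) + 3 : ℝ) ≠ 0 := by positivity
  simp only [hS, ha, hT, Matrix.mul_apply, Matrix.of_apply, ← Fin.sum_univ_eq_sum_range] at h ⊢
  field_simp
  linear_combination h

end EntrySeries

section CauchyDeterminant

lemma det_cauchy_succ {K : Type*} [Field K] (x y : ℕ → K) (h : ∀ i j, x i + y j ≠ 0) (n : ℕ) :
    (Matrix.of fun i j : Fin (n + 1) => 1 / (x i + y j)).det
      = (Matrix.of fun i j : Fin n => 1 / (x i + y j)).det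
        * ((∏ i ∈ range n, (x n - x i) / (x i + y n))
          * (∏ j ∈ range n, (y n - y j) / (x n + y j)) / (x n + y n)) := by
  have hb : (Matrix.of fun i j : Fin (n + 1) => 1 / (x i + y j)).submatrix finSumFinEquiv
      finSumFinEquiv = Matrix.fromBlocks (Matrix.of fun i j : Fin n => 1 / (x i + y j))
        (Matrix.of fun (i : Fin n) (_ : Fin 1) => 1 / (x i + y n))
        (Matrix.of fun (_ : Fin 1) (j : Fin n) => 1 / (x n + y j))
        (Matrix.of fun _ _ : Fin 1 => 1 / (x n + y n)) := by
    ext i j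
    rcases i with i | i <;> rcases j with j | j <;> simp
  have inv : Invertible (Matrix.of fun _ _ : Fin 1 => 1 / (x n + y n)) :=
    ⟨Matrix.of fun _ _ => x n + y n,
      by ext i j; fin_cases i; fin_cases j; simp [Matrix.mul_apply, h],
      by ext i j; fin_cases i; fin_cases j; simp [Matrix.mul_apply, h]⟩
  have hinv : ⅟(Matrix.of fun _ _ : Fin 1 => 1 / (x n + y n))
      = Matrix.of fun _ _ => x n + y n :=
    invOf_eq_right_inv (by ext i j; fin_cases i; fin_cases j; simp [Matrix.mul_apply, h])
  rw [← Matrix.det_submatrix_equiv_self finSumFinEquiv, hb, Matrix.det_fromBlocks₂₂, hinv,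
    Matrix.det_fin_one, Matrix.of_apply,
    ← Fin.prod_univ_eq_prod_range (fun i => (x n - x i) / (x i + y n)),
    ← Fin.prod_univ_eq_prod_range (fun j => (y n - y j) / (x n + y j))]
  have hs : (Matrix.of fun i j : Fin n => 1 / (x i + y j))
      - (Matrix.of fun (i : Fin n) (_ : Fin 1) => 1 / (x i + y n))
        * (Matrix.of fun _ _ : Fin 1 => x n + y n)
        * (Matrix.of fun (_ : Fin 1) (j : Fin n) => 1 / (x n + y j))
      = Matrix.of fun i j : Fin n => (x n - x i) / (x i + y n) *
          ((Matrix.of fun i j : Fin n => (y n - y j) / (x n + y j) *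
            (Matrix.of fun i j : Fin n => 1 / (x i + y j)) i j) i j) := by
    ext i j
    have h1 := h i j
    have h2 := h n j
    have h3 := h i n
    simp only [Matrix.sub_apply, Matrix.mul_apply, Matrix.of_apply, univ_unique, sum_singleton]
    field_simp
    ring
  rw [hs, Matrix.det_mul_column, Matrix.det_mul_row]
  ring

end CauchyDeterminant

section Evaluation

lemma Gamma_add_nat {x : ℝ} (hx : 0 < x) (m : ℕ) :
    Real.Gamma (x + m) = Real.Gamma x * ∏ i ∈ range m, (x + i) := by
  induction m with
  | zero => simp
  | succ m ih =>
    rw [Nat.cast_succ, ← add_assoc, Real.Gamma_add_one (by positivity), ih, prod_range_succ]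
    ring

lemma rowFactor_mul_colFactor_mul_factorial (n : ℕ) :
    rowFactor n * colFactor n * n.factorial = (4 * n + 3).factorial := by
  induction n with
  | zero => simp [rowFactor_zero, colFactor_zero, Nat.factorial]
  | succ n ih =>
    rw [rowFactor_succ, colFactor_succ, Nat.factorial_succ,
      show 4 * (n + 1) + 3 = 4 * n + 3 + 1 + 1 + 1 + 1 by ring, Nat.factorial_succ (_ + 1 + 1 + 1),
      Nat.factorial_succ (_ + 1 + 1), Nat.factorial_succ (_ + 1), Nat.factorial_succ (4 * n + 3)]
    push_cast
    rw [← ih]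
    ring

lemma factorial_mul_prod (a m : ℕ) :
    (a.factorial : ℝ) * ∏ i ∈ range m, ((a : ℝ) + 1 + i) = (a + m).factorial := by
  induction m with
  | zero => simp
  | succ m ih =>
    rw [prod_range_succ, ← mul_assoc, ih, ← add_assoc, Nat.factorial_succ]
    push_cast
    ring

lemma prod_range_sub_eq_factorial (n : ℕ) : ∏ i ∈ range n, ((n : ℝ) - i) = n.factorial := by
  rw [← prod_range_add_one_eq_factorial, ← prod_range_reflect]
  push_cast
  refine prod_congr rfl fun i hi => ?_
  rw [mem_range] at hi
  rw [Nat.sub_sub, Nat.cast_sub (by omega)]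
  push_cast
  ring

lemma det_entry_succ (n : ℕ) :
    (Matrix.of fun i j : Fin (n + 1) => entry i j).det
      = (Matrix.of fun i j : Fin n => entry i j).det
        * (Real.Gamma (4 * ((n + 1 : ℕ) : ℝ)) * Real.Gamma ((((n + 1 : ℕ) : ℝ) + 2) / 2)
            / (Real.Gamma (3 * ((n + 1 : ℕ) : ℝ)) * Real.Gamma ((3 * ((n + 1 : ℕ) : ℝ) + 2) / 2))) := by
  have hG4 : Real.Gamma (4 * ((n + 1 : ℕ) : ℝ)) = (4 * n + 3).factorial := by
    rw [← Real.Gamma_nat_eq_factorial]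
    congr 1
    push_cast
    ring
  have hG3 : Real.Gamma (3 * ((n + 1 : ℕ) : ℝ)) = (3 * n + 2).factorial := by
    rw [← Real.Gamma_nat_eq_factorial]
    congr 1
    push_cast
    ring
  have hG : Real.Gamma ((3 * ((n + 1 : ℕ) : ℝ) + 2) / 2)
      = Real.Gamma ((((n + 1 : ℕ) : ℝ) + 2) / 2)
        * ((∏ i ∈ range n, (2 * (i : ℝ) + n + 3)) * (3 * n + 3) / 2 ^ (n + 1)) := by
    rw [show (3 * ((n + 1 : ℕ) : ℝ) + 2) / 2 = (((n + 1 : ℕ) : ℝ) + 2) / 2 + (n + 1 : ℕ) by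
      push_cast; ring, Gamma_add_nat (by positivity)]
    congr 1
    rw [eq_div_iff (by positivity), show (3 * (n : ℝ) + 3) = 2 * n + n + 3 by ring,
      ← prod_range_succ (fun i : ℕ => 2 * (i : ℝ) + n + 3), ← card_range (n + 1), ← prod_const,
      card_range, ← prod_mul_distrib]
    refine prod_congr rfl fun i _ => ?_
    push_cast
    ring
  have h0 := det_entry_mul n
  have h1 := det_entry_mul (n + 1)
  have hC := det_cauchy_succ (fun k : ℕ => 2 * (k : ℝ)) (fun l : ℕ => (l : ℝ) + 3)
    (fun i j => by positivity) n
  simp only [← add_assoc, prod_div_distrib] at hC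
  rw [hC] at h1
  simp only [Fin.prod_univ_eq_prod_range (fun k => (((2 * k + 2).factorial : ℝ) / 2)),
    Fin.prod_univ_eq_prod_range (fun k => (k.factorial : ℝ)),
    Fin.prod_univ_eq_prod_range rowFactor, Fin.prod_univ_eq_prod_range colFactor] at h0 h1
  have e1 : ∏ i ∈ range n, (2 * (n : ℝ) - 2 * i) = 2 ^ n * n.factorial := by
    rw [← prod_range_sub_eq_factorial]
    conv_rhs => rw [← card_range n, ← prod_const, card_range, ← prod_mul_distrib]
    exact prod_congr rfl fun i _ => by ring
  have e2 : ∏ i ∈ range n, ((n : ℝ) + 3 - (i + 3)) = n.factorial := by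
    rw [← prod_range_sub_eq_factorial]
    exact prod_congr rfl fun i _ => by ring
  have e3 : ((2 * n + 2).factorial : ℝ) * ∏ i ∈ range n, (2 * (n : ℝ) + i + 3)
      = (3 * n + 2).factorial := by
    rw [show 3 * n + 2 = 2 * n + 2 + n by ring, ← factorial_mul_prod (2 * n + 2) n]
    congr 1
    refine prod_congr rfl fun i _ => ?_
    push_cast
    ring
  have e4 := rowFactor_mul_colFactor_mul_factorial n
  rw [e1, e2, prod_range_succ, prod_range_succ rowFactor, prod_range_succ colFactor,
    prod_range_succ (fun k : ℕ => (k.factorial : ℝ))] at h1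
  rw [hG4, hG3, hG, ← e3, ← e4]
  have hP : ∏ k ∈ range n, (((2 * k + 2).factorial : ℝ) / 2) ≠ 0 :=
    prod_ne_zero_iff.mpr fun k _ => by positivity
  have hL : ∏ k ∈ range n, (k.factorial : ℝ) ≠ 0 := prod_ne_zero_iff.mpr fun k _ => by positivity
  have hA : ∏ i ∈ range n, (2 * (i : ℝ) + n + 3) ≠ 0 :=
    prod_ne_zero_iff.mpr fun k _ => by positivity
  have hB : ∏ i ∈ range n, (2 * (n : ℝ) + i + 3) ≠ 0 :=
    prod_ne_zero_iff.mpr fun k _ => by positivity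
  have hg : ((2 * n + 2).factorial : ℝ) ≠ 0 := by positivity
  have hf : (n.factorial : ℝ) ≠ 0 := by positivity
  have hn : (3 * (n : ℝ) + 3) ≠ 0 := by positivity
  have hG0 : Real.Gamma ((((n + 1 : ℕ) : ℝ) + 2) / 2) ≠ 0 :=
    (Real.Gamma_pos_of_pos (by positivity)).ne'
  rw [show 2 * (n : ℝ) + n + 3 = 3 * n + 3 by ring] at h1
  generalize (Matrix.of fun i j : Fin n => entry i j).det = d at *
  generalize (Matrix.of fun i j : Fin (n + 1) => entry i j).det = d' at *
  generalize (Matrix.of fun i j : Fin n => (1 / (2 * (i : ℕ) + (j : ℕ) + 3) : ℝ)).det = κ at *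
  generalize ∏ k ∈ range n, (((2 * k + 2).factorial : ℝ) / 2) = P at *
  generalize ∏ k ∈ range n, (k.factorial : ℝ) = L at *
  generalize ∏ i ∈ range n, (2 * (i : ℝ) + n + 3) = a at *
  generalize ∏ i ∈ range n, (2 * (n : ℝ) + i + 3) = b at *
  generalize Real.Gamma ((((n + 1 : ℕ) : ℝ) + 2) / 2) = G at *
  generalize ((2 * n + 2).factorial : ℝ) = g at *
  generalize (n.factorial : ℝ) = f at *
  generalize rowFactor n = r at *
  generalize colFactor n = c at *
  generalize 3 * (n : ℝ) + 3 = w at *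
  have hM : P * (g / 2) * (L * f) ≠ 0 := by simp [hP, hL, hg, hf]
  apply mul_left_cancel₀ hM
  have hr : P * (g / 2) * (L * f) * (d * (r * c * f * G / (g * b * (G * (a * w / 2 ^ (n + 1))))))
      = r * c * (2 ^ n * f / a * (f / b) / w) * (P * d * L) := by
    field_simp
    ring
  rw [hr, h0]
  linear_combination h1

lemma binom_natCast (N p : ℕ) : binom (N : ℤ) p = (N.choose p : ℝ) := by
  rw [binom, Nat.choose_eq_descFactorial_div_factorial,
    Nat.cast_div (Nat.factorial_dvd_descFactorial _ _) (by positivity),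
    ← descPochhammer_eval_eq_descFactorial ℝ, descPochhammer_eval_eq_prod_range]
  rfl

lemma binom_reflect (i j : ℕ) :
    binom (2 * (i : ℤ) - j) (2 * i + 2) = ((j + 1).choose (2 * i + 2) : ℝ) := by
  rw [← binom_natCast, binom, binom, ← prod_range_reflect]
  congr 1
  have h : ((-1 : ℝ)) ^ (2 * i + 2) = 1 := Even.neg_one_pow ⟨i + 1, by ring⟩
  rw [← one_mul (∏ k ∈ range (2 * i + 2), (((j + 1 : ℕ) : ℤ) - (k : ℝ))), ← h,
    ← card_range (2 * i + 2), ← prod_const, card_range, ← prod_mul_distrib]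
  refine prod_congr rfl fun k hk => ?_
  rw [mem_range] at hk
  rw [Nat.sub_sub, Nat.cast_sub (by omega)]
  push_cast
  ring

end Evaluation

end

theorem stmt_9 (n : ℕ) (hn : 0 < n) :
    (Matrix.of fun i j : Fin n =>
        (2 : ℝ) ^ ((j : ℕ) + 1) * binom (2 * ((i : ℕ) : ℤ) + ((j : ℕ) : ℤ) + 2) (2 * (i : ℕ) + 2)
          + binom (2 * ((i : ℕ) : ℤ) - ((j : ℕ) : ℤ)) (2 * (i : ℕ) + 2)).det =
      ∏ i ∈ Finset.Icc 1 n,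
          Real.Gamma (4 * (i : ℝ)) * Real.Gamma (((i : ℝ) + 2) / 2)
            / (Real.Gamma (3 * (i : ℝ)) * Real.Gamma ((3 * (i : ℝ) + 2) / 2)) := by
  have h : (Matrix.of fun i j : Fin n =>
      (2 : ℝ) ^ ((j : ℕ) + 1) * binom (2 * ((i : ℕ) : ℤ) + ((j : ℕ) : ℤ) + 2) (2 * (i : ℕ) + 2)
        + binom (2 * ((i : ℕ) : ℤ) - ((j : ℕ) : ℤ)) (2 * (i : ℕ) + 2))
      = Matrix.of fun i j : Fin n => entry i j := by
    ext i j
    rw [Matrix.of_apply, Matrix.of_apply, binom_reflect, entry, ← binom_natCast (2 * _ + _ + 2)]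
    norm_cast
  rw [h]
  clear h hn
  induction n with
  | zero => simp
  | succ n ih => rw [det_entry_succ, ih, Finset.prod_Icc_succ_top (by omega)]
end

section
/- For every integer s ≥ 1, every integer r ≥ 0, and every positive integer n, the determinant of the n×n matrix whose (i,j)-entry (0 ≤ i,j ≤ n−1) is the binomial coefficient C((s+1)i + r, j) equals (s+1)^{n(n−1)/2}. -/
namespace Matrix

/-- A Vandermonde determinant on natural numbers is a product of factorials times the determinant
of the corresponding matrix of binomial coefficients. -/
lemma det_vandermonde_natCast_eq_prod_factorial_mul_det_choose {n : ℕ} (v : Fin n → ℕ) :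
    (vandermonde fun i => (v i : ℤ)).det =
      (∏ j : Fin n, (Nat.factorial j : ℤ)) *
        (of fun i j : Fin n => ((v i).choose j : ℤ)).det := by
  rw [det_eval_matrixOfPolynomials_eq_det_vandermonde (fun i => (v i : ℤ))
    (fun j => descPochhammer ℤ j) (fun j => descPochhammer_natDegree ℤ j)
    (fun j => monic_descPochhammer ℤ j), ← det_mul_row]
  congr 1
  ext i j
  simp only [of_apply]
  rw [descPochhammer_eval_eq_descFactorial ℤ, Nat.descFactorial_eq_factorial_mul_choose,
    Nat.cast_mul]

lemma det_vandermonde_const_mul {R : Type*} [CommRing R] {n : ℕ} (c : R) (v : Fin n → R) :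
    (vandermonde fun i => c * v i).det = c ^ (n * (n - 1) / 2) * (vandermonde v).det := by
  have h : (vandermonde fun i => c * v i) =
      of fun i j : Fin n => c ^ (j : ℕ) * vandermonde v i j := by
    ext i j
    simp [vandermonde_apply, mul_pow]
  rw [h, det_mul_row, Finset.prod_pow_eq_pow_sum, Fin.sum_univ_eq_sum_range (fun j => j),
    Finset.sum_range_id]

lemma det_choose_eq_one (n : ℕ) :
    (of fun i j : Fin n => ((i : ℕ).choose (j : ℕ) : ℤ)).det = 1 := by
  rw [det_of_isLowerTriangular]
  · simp
  · intro i j hij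
    simpa using Nat.choose_eq_zero_of_lt (show (i : ℕ) < j from hij)

end Matrix

theorem stmt_13 (s r : ℕ) (hs : 1 ≤ s) (n : ℕ) (hn : 0 < n) :
    (Matrix.of fun i j : Fin n =>
        ((((s + 1) * (i : ℕ) + r).choose (j : ℕ) : ℤ))).det =
      (s + 1) ^ (n * (n - 1) / 2) := by
  have hfac : (∏ j : Fin n, (Nat.factorial j : ℤ)) ≠ 0 :=
    Finset.prod_ne_zero_iff.mpr fun j _ => Nat.cast_ne_zero.mpr (Nat.factorial_ne_zero j)
  apply mul_left_cancel₀ hfac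
  rw [← Matrix.det_vandermonde_natCast_eq_prod_factorial_mul_det_choose fun i => (s + 1) * (i : ℕ) + r]
  push_cast
  rw [Matrix.det_vandermonde_add, Matrix.det_vandermonde_const_mul,
    Matrix.det_vandermonde_natCast_eq_prod_factorial_mul_det_choose (fun i : Fin n => (i : ℕ)),
    Matrix.det_choose_eq_one, mul_one, mul_comm]
end

section
/- Fix a real number l and let D : ℤ × ℤ → ℝ be the unique function satisfying: D(i,j) = 0 whenever i < 0 or j < 0; D(0,0) = 1; and D(i,j) = 1·D(i−1,j) + (l−1)·D(i,j−1) + 1·D(i−1,j−1) for all (i,j) with i,j ≥ 0 and (i,j) ≠ (0,0). Then for all integers m ≥ 1 and a ≥ 0 and every positive integer n, the determinant of the n×n matrix whose (i,j)-entry (0 ≤ i,j ≤ n−1) is D(mi − j + a, j) equals one half of the determinant of the n×n matrix whose (i,j)-entry is l^{j}·binom(mi+j+a, mi+a) + binom(mi−j+a, mi+a). -/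
open scoped BigOperators

/-- If `D` satisfies the weighted Delannoy recurrence and `u + v = 1 + (l - 1) y`, `u v = -y`, then
the antidiagonals of `D` are the Lucas sequence with roots `u` and `v`. -/
theorem delannoy_antidiagonal_lucas {R : Type*} [CommRing R] [Algebra ℝ R]
    (l : ℝ) (D : ℤ → ℤ → ℝ)
    (hDbd : ∀ i j : ℤ, i < 0 ∨ j < 0 → D i j = 0)
    (hD00 : D 0 0 = 1)
    (hDrec : ∀ i j : ℤ, 0 ≤ i → 0 ≤ j → (i, j) ≠ (0, 0) →
      D i j = 1 * D (i - 1) j + (l - 1) * D i (j - 1) + 1 * D (i - 1) (j - 1))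
    (u v y : R) (hadd : u + v = 1 + algebraMap ℝ R (l - 1) * y) (hmul : u * v = -y) (N : ℕ) :
    ∀ M : ℕ, N < M → u ^ (N + 1) - v ^ (N + 1) =
      (u - v) * ∑ k ∈ Finset.range M, algebraMap ℝ R (D ((N : ℤ) - k) k) * y ^ k := by
  have hrec : ∀ N k : ℕ, D ((N + 1 : ℕ) - k) k =
      D ((N : ℤ) - k) k + (l - 1) * D ((N : ℤ) - (k - 1)) (k - 1)
        + D ((N : ℤ) - 1 - (k - 1)) (k - 1) := by
    intro N k
    rcases lt_or_ge (((N + 1 : ℕ) : ℤ) - k) 0 with h | h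
    · rw [hDbd _ _ (Or.inl h), hDbd _ _ (Or.inl (by push_cast at h; omega)),
        hDbd _ _ (Or.inl (by push_cast at h; omega)),
        hDbd _ _ (Or.inl (by push_cast at h; omega))]
      ring
    · rw [hDrec _ _ h (by positivity) (by simp only [ne_eq, Prod.mk.injEq]; omega), one_mul, one_mul]
      congr 2
      · congr 1; push_cast; ring
      · congr 2; push_cast; ring
      · push_cast; ring
  induction N using Nat.strong_induction_on with
  | _ N ih =>
    intro M hM
    obtain ⟨M, rfl⟩ : ∃ K, M = K + 1 := ⟨M - 1, by omega⟩
    match N, ih, hM with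
    | 0, _, _ =>
      rw [Finset.sum_range_succ', Finset.sum_eq_zero]
      · simp [hD00]
      · intro k _
        rw [hDbd _ _ (Or.inl (by push_cast; omega))]
        simp
    | 1, _, hM =>
      obtain ⟨M, rfl⟩ : ∃ K, M = K + 1 := ⟨M - 1, by omega⟩
      rw [Finset.sum_range_succ', Finset.sum_range_succ', Finset.sum_eq_zero]
      · have h1 := hrec 0 0
        have h2 := hrec 0 1
        rw [hDbd _ _ (Or.inr (show (((0 : ℕ) : ℤ) - 1) < 0 by simp)),
          hDbd _ _ (Or.inr (show (((0 : ℕ) : ℤ) - 1) < 0 by simp))] at h1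
        rw [hDbd (((0 : ℕ) : ℤ) - (1 : ℕ)) _ (Or.inl (by simp)),
          hDbd (((0 : ℕ) : ℤ) - 1 - _) _ (Or.inl (by simp))] at h2
        simp [hD00] at h1 h2
        simp only [map_sub, map_one] at hadd
        simp [h1, h2]
        linear_combination (u - v) * hadd
      · intro k _
        rw [hDbd _ _ (Or.inl (by push_cast; omega))]
        simp
    | N + 2, ih, hM =>
      have h1 := ih (N + 1) (by omega) (M + 1) (by omega)
      have h1' := ih (N + 1) (by omega) M (by omega)
      have h0 := ih N (by omega) M (by omega)
      have key : ∑ k ∈ Finset.range (M + 1),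
            algebraMap ℝ R (D (((N + 2 : ℕ) : ℤ) - k) k) * y ^ k =
          ∑ k ∈ Finset.range (M + 1), algebraMap ℝ R (D (((N + 1 : ℕ) : ℤ) - k) k) * y ^ k
          + algebraMap ℝ R (l - 1) * y *
            ∑ k ∈ Finset.range M, algebraMap ℝ R (D (((N + 1 : ℕ) : ℤ) - k) k) * y ^ k
          + y * ∑ k ∈ Finset.range M, algebraMap ℝ R (D ((N : ℤ) - k) k) * y ^ k := by
        simp only [hrec (N + 1), map_add, map_mul, add_mul, Finset.sum_add_distrib]
        congr 1
        · congr 1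
          rw [Finset.sum_range_succ', Finset.mul_sum,
            hDbd _ _ (Or.inr (show (((0 : ℕ) : ℤ) - 1) < 0 by simp))]
          simp only [map_zero, mul_zero, zero_mul, add_zero]
          refine Finset.sum_congr rfl fun k _ => ?_
          rw [show ((k + 1 : ℕ) : ℤ) - 1 = k by push_cast; ring]
          ring
        · rw [Finset.sum_range_succ', Finset.mul_sum,
            hDbd _ _ (Or.inr (show (((0 : ℕ) : ℤ) - 1) < 0 by simp))]
          simp only [map_zero, zero_mul, add_zero]
          refine Finset.sum_congr rfl fun k _ => ?_
          rw [show ((k + 1 : ℕ) : ℤ) - 1 = k by push_cast; ring,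
            show ((N + 1 : ℕ) : ℤ) - 1 = N by push_cast; ring]
          ring
      rw [key]
      linear_combination (u ^ (N + 2) - v ^ (N + 2)) * hadd - (u ^ (N + 1) - v ^ (N + 1)) * hmul
        + h1 + algebraMap ℝ R (l - 1) * y * h1' + y * h0

theorem binom_natCast_s18 (n p : ℕ) : binom n p = (n.choose p : ℝ) := by
  rw [binom, Nat.choose_eq_descFactorial_div_factorial,
    Nat.cast_div (Nat.factorial_dvd_descFactorial _ _) (by positivity),
    ← descPochhammer_eval_eq_descFactorial, descPochhammer_eval_eq_prod_range]
  simp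

theorem binom_neg_succ (t p : ℕ) :
    binom (-((t : ℤ) + 1)) p = (-1) ^ p * ((t + p).choose p : ℝ) := by
  have h : ∏ k ∈ Finset.range p, (((-((t : ℤ) + 1) : ℤ) : ℝ) - k) =
      (-1) ^ p * ((t + 1).ascFactorial p : ℝ) := by
    rw [Nat.ascFactorial_eq_prod_range, Nat.cast_prod, ← Finset.card_range p,
      ← Finset.prod_const, Finset.card_range, ← Finset.prod_mul_distrib]
    refine Finset.prod_congr rfl fun k _ => ?_
    push_cast
    ring
  rw [binom, h, Nat.ascFactorial_eq_factorial_mul_choose]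
  push_cast
  field_simp

section PowerSeries

open PowerSeries

theorem coeff_mk_pow_pow (l : ℝ) (N j : ℕ) :
    coeff j ((mk fun i => l ^ i) ^ (N + 1)) = l ^ j * binom ((N : ℤ) + j) N := by
  have h : (mk fun i => l ^ i) = rescale l (mk 1) := by ext; simp
  rw [h, ← map_pow, mk_one_pow_eq_mk_choose_add, coeff_rescale, coeff_mk, ← Nat.cast_add,
    binom_natCast_s18]

theorem coeff_neg_X_mul_mk_one_pow (N j : ℕ) :
    coeff j ((-(X * mk 1) : PowerSeries ℝ) ^ (N + 1)) =
      (if j = 0 then 1 else 0) - binom ((N : ℤ) - j) N := by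
  rw [← neg_mul, mul_pow, neg_pow, mk_one_pow_eq_mk_choose_add, mul_assoc,
    show ((-1 : PowerSeries ℝ) ^ (N + 1)) = C ((-1 : ℝ) ^ (N + 1)) by simp,
    coeff_C_mul, coeff_X_pow_mul']
  split_ifs with h h0 h0
  · omega
  · obtain ⟨t, rfl⟩ := Nat.exists_eq_add_of_le h
    rw [show (N : ℤ) - ((N + 1 + t : ℕ) : ℤ) = -((t : ℤ) + 1) by push_cast; ring, binom_neg_succ,
      coeff_mk, Nat.add_sub_cancel_left, add_comm N t]
    ring
  · subst h0
    have := binom_natCast_s18 N N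
    simp_all
  · rw [← Nat.cast_sub (by omega), binom_natCast_s18, Nat.choose_eq_zero_of_lt (show N - j < N by omega)]
    simp

/-- The matrix of coefficients of `g * (X * w) ^ k` is upper unitriangular when `g` and `w` have constant
coefficient `1`. -/
theorem det_coeff_mul_pow (g w : PowerSeries ℝ) (hg : constantCoeff g = 1)
    (hw : constantCoeff w = 1) (n : ℕ) :
    (Matrix.of fun k j : Fin n => coeff (j : ℕ) (g * (X * w) ^ (k : ℕ))).det = 1 := by
  have hc : ∀ k j : ℕ, coeff j (g * (X * w) ^ k) =
      if k ≤ j then coeff (j - k) (g * w ^ k) else 0 := by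
    intro k j
    rw [mul_pow, mul_left_comm, coeff_X_pow_mul']
  rw [Matrix.det_of_isUpperTriangular]
  · refine Finset.prod_eq_one fun i _ => ?_
    simp [hc, hg, hw]
  · intro i j hij
    have : ¬ (i : ℕ) ≤ (j : ℕ) := by simpa using hij
    simp only [Matrix.of_apply, hc, if_neg this]

end PowerSeries

theorem stmt_18 (l : ℝ) (D : ℤ → ℤ → ℝ)
    (hDbd : ∀ i j : ℤ, i < 0 ∨ j < 0 → D i j = 0)
    (hD00 : D 0 0 = 1)
    (hDrec : ∀ i j : ℤ, 0 ≤ i → 0 ≤ j → (i, j) ≠ (0, 0) →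
      D i j = 1 * D (i - 1) j + (l - 1) * D i (j - 1) + 1 * D (i - 1) (j - 1))
    (m a : ℕ) (hm : 1 ≤ m) (n : ℕ) (hn : 0 < n) :
    (Matrix.of fun i j : Fin n =>
        D (((m * (i : ℕ) + a : ℕ) : ℤ) - ((j : ℕ) : ℤ)) ((j : ℕ) : ℤ)).det =
      (1 / 2) * (Matrix.of fun i j : Fin n =>
        l ^ (j : ℕ) * binom (((m * (i : ℕ) + a : ℕ) : ℤ) + ((j : ℕ) : ℤ)) (m * (i : ℕ) + a)
          + binom (((m * (i : ℕ) + a : ℕ) : ℤ) - ((j : ℕ) : ℤ)) (m * (i : ℕ) + a)).det := by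
  obtain ⟨n, rfl⟩ : ∃ k, n = k + 1 := ⟨n - 1, by omega⟩
  set P : PowerSeries ℝ := PowerSeries.mk fun i => l ^ i with hP
  set Q : PowerSeries ℝ := PowerSeries.mk 1 with hQ
  have hP1 : P * (1 - PowerSeries.C l * PowerSeries.X) = 1 := by
    ext k
    rw [mul_sub, mul_one, mul_left_comm, map_sub, PowerSeries.coeff_C_mul]
    cases k with
    | zero => simp [hP]
    | succ k =>
      rw [PowerSeries.coeff_succ_mul_X]
      simp [hP, PowerSeries.coeff_one, pow_succ']
  have hQ1 : Q * (1 - PowerSeries.X) = 1 := PowerSeries.mk_one_mul_one_sub_eq_one ℝ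
  have hP0 : PowerSeries.constantCoeff P = 1 := by simp [hP]
  have hQ0 : PowerSeries.constantCoeff Q = 1 := by simp [hQ]
  set B : PowerSeries ℝ := -(PowerSeries.X * Q) with hB
  have hadd : P + B = 1 + algebraMap ℝ (PowerSeries ℝ) (l - 1) * (PowerSeries.X * (P * Q)) := by
    rw [PowerSeries.algebraMap_apply, Algebra.algebraMap_self_apply, map_sub, map_one]
    linear_combination Q * hP1 + (1 - P) * hQ1
  have hmul : P * B = -(PowerSeries.X * (P * Q)) := by rw [hB]; ring
  set U : Matrix (Fin (n + 1)) (Fin (n + 1)) ℝ := Matrix.of fun k j =>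
    PowerSeries.coeff (j : ℕ) ((P - B) * (PowerSeries.X * (P * Q)) ^ (k : ℕ)) with hU
  have hUdet : U.det = 1 :=
    det_coeff_mul_pow _ _ (by simp [hB, hP0]) (by simp [hP0, hQ0]) _
  have hUentry : ∀ N : ℕ, ∀ j : Fin (n + 1),
      ∑ k : Fin (n + 1), D ((N : ℤ) - (k : ℕ)) (k : ℕ) * U k j =
        PowerSeries.coeff (j : ℕ) (P ^ (N + 1) - B ^ (N + 1)) := by
    intro N j
    rw [delannoy_antidiagonal_lucas l D hDbd hD00 hDrec P B _ hadd hmul N (n + 1 + (N + 1))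
      (by omega), Finset.mul_sum, map_sum, Finset.sum_range_add, Finset.sum_range]
    rw [Finset.sum_eq_zero (s := Finset.range (N + 1)), add_zero]
    · refine Finset.sum_congr rfl fun k _ => ?_
      rw [PowerSeries.algebraMap_apply, Algebra.algebraMap_self_apply, mul_left_comm,
        PowerSeries.coeff_C_mul]
      rfl
    · intro k _
      rw [mul_pow, mul_left_comm _ (PowerSeries.X ^ _), mul_left_comm _ (PowerSeries.X ^ _),
        PowerSeries.coeff_X_pow_mul', if_neg (by omega)]
  have hprod : (Matrix.of fun i j : Fin (n + 1) =>
        D (((m * (i : ℕ) + a : ℕ) : ℤ) - ((j : ℕ) : ℤ)) ((j : ℕ) : ℤ)) * U =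
      Matrix.of fun i j : Fin (n + 1) => PowerSeries.coeff (j : ℕ)
        (P ^ (m * (i : ℕ) + a + 1) - B ^ (m * (i : ℕ) + a + 1)) := by
    ext i j
    rw [Matrix.mul_apply]
    exact hUentry _ j
  have hcoeff : ∀ N j : ℕ, l ^ j * binom ((N : ℤ) + j) N + binom ((N : ℤ) - j) N =
      (if j = 0 then 2 else 1) * PowerSeries.coeff j (P ^ (N + 1) - B ^ (N + 1)) := by
    intro N j
    rw [map_sub, coeff_mk_pow_pow, coeff_neg_X_mul_mk_one_pow]
    split_ifs with h
    · subst h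
      have := binom_natCast_s18 N N
      simp_all
      norm_num
    · ring
  have hdet := Matrix.det_mul_row (fun j : Fin (n + 1) => if (j : ℕ) = 0 then (2 : ℝ) else 1)
    (Matrix.of fun i j : Fin (n + 1) => PowerSeries.coeff (j : ℕ)
        (P ^ (m * (i : ℕ) + a + 1) - B ^ (m * (i : ℕ) + a + 1)))
  simp only [Matrix.of_apply] at hdet
  simp only [hcoeff]
  rw [hdet, ← hprod, Matrix.det_mul, hUdet, Fin.prod_univ_succ]
  simp
end

section
/- Fix a real number l and let D : ℤ × ℤ → ℝ be the unique function satisfying: D(i,j) = 0 whenever i < 0 or j < 0; D(0,0) = 1; and D(i,j) = 1·D(i−1,j) + (l−1)·D(i,j−1) + 1·D(i−1,j−1) for all (i,j) with i,j ≥ 0 and (i,j) ≠ (0,0). Define H(i,j) := D(i, j+1) − D(i−1, j+1) for all integers i, j. Then for all integers m ≥ 1 and a ≥ 0 and every positive integer n, the determinant of the n×n matrix whose (i,j)-entry (0 ≤ i,j ≤ n−1) is H(mi − j + a, j) equals the determinant of the n×n matrix whose (i,j)-entry is l^{j+1}·binom(mi+j+a+1, mi+a+1) + binom(mi−j+a−1,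 mi+a+1). -/
open scoped BigOperators

open PowerSeries in
theorem mk_one_mul_one_sub_X : (PowerSeries.mk 1 : ℝ⟦X⟧) * (1 - X) = 1 :=
  PowerSeries.mk_one_mul_one_sub_eq_one ℝ

theorem binom_zero_right (α : ℤ) : binom α 0 = 1 := by
  simp [binom]

theorem binom_succ_succ (α : ℤ) (p : ℕ) :
    binom (α + 1) (p + 1) = binom α (p + 1) + binom α p := by
  have hshift : ∏ k ∈ Finset.range p, (((α + 1 : ℤ) : ℝ) - ((k + 1 : ℕ) : ℝ)) =
      ∏ k ∈ Finset.range p, ((α : ℝ) - (k : ℝ)) :=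
    Finset.prod_congr rfl fun k _ => by push_cast; ring
  unfold binom
  rw [Finset.prod_range_succ', hshift, Finset.prod_range_succ, Nat.factorial_succ]
  have := Nat.factorial_ne_zero p
  push_cast
  field_simp
  ring

theorem binom_natCast_of_lt {q p : ℕ} (h : q < p) : binom (q : ℤ) p = 0 := by
  unfold binom
  rw [Finset.prod_eq_zero (Finset.mem_range.mpr h) (by simp), zero_div]

theorem binom_natCast_s19 (q p : ℕ) : binom (q : ℤ) p = (q.choose p : ℝ) := by
  induction q generalizing p with
  | zero =>
    cases p with
    | zero => simp [binom_zero_right]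
    | succ p => simpa using binom_natCast_of_lt p.succ_pos
  | succ q ih =>
    cases p with
    | zero => simp [binom_zero_right]
    | succ p =>
      rw [Nat.cast_succ, binom_succ_succ, ih, ih, Nat.choose_succ_succ']
      push_cast
      ring

open PowerSeries in
theorem coeff_one_sub_X_pow (k p : ℕ) :
    coeff p ((1 - X : ℝ⟦X⟧) ^ k) = binom ((p : ℤ) - k - 1) p := by
  induction k generalizing p with
  | zero =>
    cases p with
    | zero => simp [binom_zero_right]
    | succ p =>
      have h : ((p + 1 : ℕ) : ℤ) - (0 : ℕ) - 1 = (p : ℤ) := by push_cast; ring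
      rw [h, binom_natCast_of_lt p.lt_succ_self]
      simp [coeff_one]
  | succ k ih =>
    cases p with
    | zero => simp [binom_zero_right]
    | succ p =>
      have h : ((p + 1 : ℕ) : ℤ) - k - 1 = ((p : ℤ) - k - 1) + 1 := by push_cast; ring
      have h' : ((p + 1 : ℕ) : ℤ) - (k + 1 : ℕ) - 1 = (p : ℤ) - k - 1 := by push_cast; ring
      rw [pow_succ, mul_sub, mul_one, map_sub, coeff_succ_mul_X, ih, ih, h, h', binom_succ_succ]
      ring

open PowerSeries in
theorem coeff_mk_one_pow (k p : ℕ) :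
    coeff p ((PowerSeries.mk 1 : ℝ⟦X⟧) ^ (k + 1)) = binom ((p : ℤ) + k) p := by
  rw [mk_one_pow_eq_mk_choose_add, coeff_mk, ← Nat.cast_add, binom_natCast_s19, add_comm p k,
    Nat.choose_symm_add]

open Polynomial in
/-- Polynomials expressing `u ^ k + v ^ k`, where `u * v = l`, in terms of `u + v - s`. -/
noncomputable def powerSumPoly (l s : ℝ) : ℕ → ℝ[X]
  | 0 => 2
  | 1 => X + C s
  | k + 2 => (X + C s) * powerSumPoly l s (k + 1) - C l * powerSumPoly l s k

open Polynomial in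
theorem aeval_powerSumPoly {A : Type*} [CommRing A] [Algebra ℝ A] {l s : ℝ} {u v w : A}
    (huv : u * v = algebraMap ℝ A l) (hw : w + algebraMap ℝ A s = u + v) (k : ℕ) :
    aeval w (powerSumPoly l s k) = u ^ k + v ^ k := by
  induction k using Nat.twoStepInduction with
  | zero => simpa [powerSumPoly, one_add_one_eq_two] using map_ofNat (aeval w) 2
  | one => simp [powerSumPoly, hw]
  | more k ih ih' =>
    simp only [powerSumPoly, map_sub, map_mul, map_add, aeval_X, aeval_C, ih, ih', hw, ← huv]
    ring

theorem coeff_powerSumPoly_of_lt (l s : ℝ) {k r : ℕ} (h : k < r) :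
    (powerSumPoly l s k).coeff r = 0 := by
  induction k using Nat.twoStepInduction generalizing r with
  | zero => exact Polynomial.coeff_C_of_ne_zero h.ne'
  | one =>
    simp [powerSumPoly, Polynomial.coeff_X, Polynomial.coeff_C, h.ne, (zero_lt_one.trans h).ne']
  | more k ih ih' =>
    obtain ⟨r, rfl⟩ : ∃ t, r = t + 1 := ⟨r - 1, by omega⟩
    simp only [powerSumPoly, add_mul, Polynomial.coeff_sub, Polynomial.coeff_add,
      Polynomial.coeff_X_mul, Polynomial.coeff_C_mul]
    rw [ih (by omega), ih' (by omega), ih' (by omega)]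
    ring

theorem coeff_powerSumPoly_self (l s : ℝ) (k : ℕ) :
    (powerSumPoly l s (k + 1)).coeff (k + 1) = 1 := by
  induction k with
  | zero => simp [powerSumPoly]
  | succ k ih =>
    simp only [powerSumPoly, add_mul, Polynomial.coeff_sub, Polynomial.coeff_add,
      Polynomial.coeff_X_mul, Polynomial.coeff_C_mul]
    rw [ih, coeff_powerSumPoly_of_lt l s (by omega), coeff_powerSumPoly_of_lt l s (by omega)]
    ring

open PowerSeries in
/-- Replacing the powers of a power series `w` by power sums of `u` and `v` with `u * v` constant
and `u + v - w` constant does not change a determinant of coefficients of positive index. -/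
theorem det_coeff_pow_eq_det_coeff_powerSum {l s : ℝ} {u v w : ℝ⟦X⟧}
    (huv : u * v = algebraMap ℝ ℝ⟦X⟧ l) (hw : w + algebraMap ℝ ℝ⟦X⟧ s = u + v) {n : ℕ}
    (p : Fin n → ℕ) (hp : ∀ i, p i ≠ 0) :
    (Matrix.of fun i j : Fin n => coeff (p i) (w ^ ((j : ℕ) + 1))).det =
      (Matrix.of fun i j : Fin n =>
        coeff (p i) (u ^ ((j : ℕ) + 1) + v ^ ((j : ℕ) + 1))).det := by
  set T : Matrix (Fin n) (Fin n) ℝ :=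
    Matrix.of fun r j => (powerSumPoly l s ((j : ℕ) + 1)).coeff ((r : ℕ) + 1) with hT
  have hdet : T.det = 1 := by
    rw [Matrix.det_of_isUpperTriangular]
    · exact Finset.prod_eq_one fun j _ => coeff_powerSumPoly_self l s j
    · intro r j hrj
      exact coeff_powerSumPoly_of_lt l s (Nat.succ_lt_succ hrj)
  rw [← mul_one (Matrix.det _), ← hdet, ← Matrix.det_mul]
  congr 1
  ext i j
  have hdeg : (powerSumPoly l s ((j : ℕ) + 1)).natDegree < n + 1 := by
    rw [Nat.lt_succ_iff, Polynomial.natDegree_le_iff_coeff_eq_zero]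
    exact fun r hr => coeff_powerSumPoly_of_lt l s (by omega)
  rw [Matrix.mul_apply, Matrix.of_apply, ← aeval_powerSumPoly huv hw,
    Polynomial.aeval_eq_sum_range' hdeg, map_sum, Finset.sum_range_succ', Finset.sum_range]
  simp [hT, coeff_one, hp i, mul_comm]

section Delannoy

open PowerSeries

variable {l : ℝ} {D : ℤ → ℤ → ℝ}

theorem one_sub_X_mul_delannoy_zero (hDbd : ∀ i j : ℤ, i < 0 ∨ j < 0 → D i j = 0)
    (hD00 : D 0 0 = 1)
    (hDrec : ∀ i j : ℤ, 0 ≤ i → 0 ≤ j → (i, j) ≠ (0, 0) →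
      D i j = 1 * D (i - 1) j + (l - 1) * D i (j - 1) + 1 * D (i - 1) (j - 1)) :
    (1 - X) * PowerSeries.mk (fun i => D i 0) = 1 := by
  ext i
  cases i with
  | zero => simp [hD00]
  | succ i =>
    have h := hDrec (i + 1 : ℕ) 0 (by omega) le_rfl (by simp; omega)
    rw [hDbd _ (0 - 1) (by simp), hDbd _ (0 - 1) (by simp)] at h
    rw [sub_mul, one_mul, map_sub, coeff_succ_X_mul, coeff_mk, coeff_mk, h]
    simp [coeff_one]

theorem one_sub_X_mul_delannoy_succ (hDbd : ∀ i j : ℤ, i < 0 ∨ j < 0 → D i j = 0)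
    (hDrec : ∀ i j : ℤ, 0 ≤ i → 0 ≤ j → (i, j) ≠ (0, 0) →
      D i j = 1 * D (i - 1) j + (l - 1) * D i (j - 1) + 1 * D (i - 1) (j - 1)) (j : ℕ) :
    (1 - X) * PowerSeries.mk (fun i => D i (j + 1)) =
      (X + C (l - 1)) * PowerSeries.mk (fun i => D i j) := by
  ext i
  have h := hDrec i (j + 1) (by omega) (by omega) (by simp; omega)
  rw [sub_mul, one_mul, map_sub, add_mul, map_add, coeff_C_mul, coeff_mk, coeff_mk, h]
  cases i with
  | zero => simp [hDbd (-1) _ (by simp)]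
  | succ i =>
    rw [coeff_succ_X_mul, coeff_succ_X_mul]
    simp
    ring

theorem mk_delannoy (hDbd : ∀ i j : ℤ, i < 0 ∨ j < 0 → D i j = 0)
    (hD00 : D 0 0 = 1)
    (hDrec : ∀ i j : ℤ, 0 ≤ i → 0 ≤ j → (i, j) ≠ (0, 0) →
      D i j = 1 * D (i - 1) j + (l - 1) * D i (j - 1) + 1 * D (i - 1) (j - 1)) (j : ℕ) :
    PowerSeries.mk (fun i => D i j) =
      PowerSeries.mk 1 * ((X + C (l - 1)) * PowerSeries.mk 1) ^ j := by
  induction j with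
  | zero =>
    have h := one_sub_X_mul_delannoy_zero hDbd hD00 hDrec
    simp only [Nat.cast_zero]
    linear_combination PowerSeries.mk 1 * h -
      PowerSeries.mk (fun i => D i 0) * mk_one_mul_one_sub_X
  | succ j ih =>
    have h := one_sub_X_mul_delannoy_succ hDbd hDrec j
    simp only [Nat.cast_succ]
    rw [ih] at h
    linear_combination PowerSeries.mk 1 * h -
      PowerSeries.mk (fun i => D i (j + 1)) * mk_one_mul_one_sub_X

theorem hDelannoy_eq_coeff (hDbd : ∀ i j : ℤ, i < 0 ∨ j < 0 → D i j = 0)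
    (hD00 : D 0 0 = 1)
    (hDrec : ∀ i j : ℤ, 0 ≤ i → 0 ≤ j → (i, j) ≠ (0, 0) →
      D i j = 1 * D (i - 1) j + (l - 1) * D i (j - 1) + 1 * D (i - 1) (j - 1)) (i j : ℕ) :
    D ((i : ℤ) - j) (j + 1) - D ((i : ℤ) - j - 1) (j + 1) =
      coeff (i + 1) ((X * ((X + C (l - 1)) * PowerSeries.mk 1)) ^ (j + 1)) := by
  have h : ((X + C (l - 1)) * PowerSeries.mk 1) ^ (j + 1) =
      (1 - X) * PowerSeries.mk (fun i => D i (j + 1)) := by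
    have h' := mk_delannoy hDbd hD00 hDrec (j + 1)
    simp only [Nat.cast_succ] at h'
    rw [h']
    linear_combination -((X + C (l - 1)) * PowerSeries.mk 1) ^ (j + 1) * mk_one_mul_one_sub_X
  rw [mul_pow, coeff_X_pow_mul', h]
  split_ifs with hij
  · obtain ⟨d, rfl⟩ : ∃ d, i = j + d := ⟨i - j, by omega⟩
    rw [show j + d + 1 - (j + 1) = d by omega,
      show ((j + d : ℕ) : ℤ) - j = d by push_cast; ring, sub_mul, one_mul, map_sub, coeff_mk]
    cases d with
    | zero => simp [hDbd (-1) _ (by simp)]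
    | succ d => simp [coeff_succ_X_mul]
  · rw [hDbd _ _ (by omega), hDbd _ _ (by omega), sub_zero]

end Delannoy

theorem stmt_19 (l : ℝ) (D H : ℤ → ℤ → ℝ)
    (hDbd : ∀ i j : ℤ, i < 0 ∨ j < 0 → D i j = 0)
    (hD00 : D 0 0 = 1)
    (hDrec : ∀ i j : ℤ, 0 ≤ i → 0 ≤ j → (i, j) ≠ (0, 0) →
      D i j = 1 * D (i - 1) j + (l - 1) * D i (j - 1) + 1 * D (i - 1) (j - 1))
    (hH : ∀ i j : ℤ, H i j = D i (j + 1) - D (i - 1) (j + 1))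
    (m a : ℕ) (hm : 1 ≤ m) (n : ℕ) (hn : 0 < n) :
    (Matrix.of fun i j : Fin n =>
        H (((m * (i : ℕ) + a : ℕ) : ℤ) - ((j : ℕ) : ℤ)) ((j : ℕ) : ℤ)).det =
      (Matrix.of fun i j : Fin n =>
        l ^ ((j : ℕ) + 1) *
            binom (((m * (i : ℕ) + a + 1 : ℕ) : ℤ) + ((j : ℕ) : ℤ)) (m * (i : ℕ) + a + 1)
          + binom (((m * (i : ℕ) + a : ℕ) : ℤ) - ((j : ℕ) : ℤ) - 1)
              (m * (i : ℕ) + a + 1)).det := by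
  open PowerSeries in
  have huv : (C l * PowerSeries.mk 1) * (1 - X) = algebraMap ℝ ℝ⟦X⟧ l := by
    rw [mul_assoc, mk_one_mul_one_sub_X, mul_one]
    rfl
  open PowerSeries in
  have hw : X * ((X + C (l - 1)) * PowerSeries.mk 1) + algebraMap ℝ ℝ⟦X⟧ (l + 1) =
      C l * PowerSeries.mk 1 + (1 - X) := by
    change _ + C (l + 1) = _
    rw [map_sub, map_add, map_one]
    linear_combination (-X - C l) * mk_one_mul_one_sub_X
  convert det_coeff_pow_eq_det_coeff_powerSum huv hw
    (fun i : Fin n => m * (i : ℕ) + a + 1) (fun i => Nat.succ_ne_zero _) using 2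
  · ext i j
    rw [Matrix.of_apply, Matrix.of_apply, hH, hDelannoy_eq_coeff hDbd hD00 hDrec]
  · ext i j
    rw [Matrix.of_apply, Matrix.of_apply, map_add, mul_pow, ← map_pow, PowerSeries.coeff_C_mul,
      coeff_mk_one_pow, coeff_one_sub_X_pow]
    congr 2
    push_cast
    ring
end
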